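/- arXiv:1804.10721 — 4 statements merged into one kernel-verified Lean document; each statement's English description precedes it below -/
import Mathlib

section
/- Let ν be a probability measure on [0,∞) with all positive moments finite. Then Hardy's condition holds, i.e. ∫₀^∞ e^{c√x} dν(x) < ∞ for some c > 0, if and only if there exists c > 0 with limsup_{x→∞} ν((x,∞))·√x·e^{c√x} < ∞ (i.e. the tail ν((x,∞)) is O(e^{−c√x − (1/2)log x}) as x → ∞). Moreover, for every c > 0 the function x ↦ c·e^{x/2} + x/2 is an admissible asymptotically parabolic function (belongs to 𝒜_D). -/
open MeasureTheory Set Filter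

noncomputable section

/-- `G` is asymptotically parabolic on the interval `(a, ∞)` (with `a ∈ [-∞, ∞)` an
extended real): `G` is twice continuously differentiable there, `G'' > 0` there, and
`G''(u + w (G''(u))^{-1/2}) / G''(u) → 1` as `u → ∞` locally uniformly in `w`. -/
def AsympParabolic (a : EReal) (G : ℝ → ℝ) : Prop :=
  a < ⊤ ∧
  ContDiffOn ℝ 2 G {u : ℝ | a < (u : EReal)} ∧
  (∀ u : ℝ, a < (u : EReal) → 0 < deriv (deriv G) u) ∧
  ∀ W > (0:ℝ), ∀ ε > (0:ℝ), ∃ U : ℝ, ∀ u ≥ U, ∀ w : ℝ, |w| ≤ W →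
    |deriv (deriv G) (u + w * (deriv (deriv G) u) ^ (-(1:ℝ)/2)) / deriv (deriv G) u - 1| < ε

/-- An asymptotically parabolic function is admissible if `G(x)/x → ∞`. -/
def AdmissibleAP (a : EReal) (G : ℝ → ℝ) : Prop :=
  AsympParabolic a G ∧ Tendsto (fun x => G x / x) atTop atTop

/-- The `n`-th moment of a measure `ν` (supported on `[0,∞)`). -/
def Mnu (ν : Measure ℝ) (n : ℕ) : ℝ := ∫ x, x ^ n ∂ν

/-- The complex moment transform `z ↦ ∫₀^∞ x^z dν(x)`. -/
def Mc (ν : Measure ℝ) (z : ℂ) : ℂ := ∫ x in Ioi (0:ℝ), (x : ℂ) ^ z ∂ν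

/-- The real moment transform `u ↦ ∫₀^∞ x^u dν(x)`. -/
def Mr (ν : Measure ℝ) (u : ℝ) : ℝ := ∫ x in Ioi (0:ℝ), x ^ u ∂ν

/-- `η(n) = ((log M_ν)''(n))^{1/2}`. -/
def eta (ν : Measure ℝ) (n : ℕ) : ℝ :=
  Real.sqrt (deriv (deriv fun u : ℝ => Real.log (Mr ν u)) (n : ℝ))

/-- The (topological) support of `ν` is exactly `[0, ∞)`. -/
def SupportIsIci (ν : Measure ℝ) : Prop :=
  ν (Iio (0:ℝ)) = 0 ∧ ∀ x : ℝ, 0 ≤ x → ∀ ε > (0:ℝ), 0 < ν (Ioo (x - ε) (x + ε))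

/-- `ν` is moment determinate: any nonnegative Borel measure on `[0,∞)` with the same
(finite) moment sequence equals `ν`. -/
def MomentDeterminate (ν : Measure ℝ) : Prop :=
  ∀ μ : Measure ℝ, μ (Iio (0:ℝ)) = 0 → (∀ n : ℕ, Integrable (fun x => x ^ n) μ) →
    (∀ n : ℕ, Mnu μ n = Mnu ν n) → μ = ν

/-- `ν` is moment indeterminate. -/
def MomentIndeterminate (ν : Measure ℝ) : Prop := ¬ MomentDeterminate ν

lemma deriv_deriv_const_mul_exp_half_add_half (c : ℝ) :
    deriv (deriv fun x : ℝ => c * Real.exp (x / 2) + x / 2) =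
      fun x => c / 4 * Real.exp (x / 2) := by
  have hexp (x : ℝ) : HasDerivAt (fun y : ℝ => Real.exp (y / 2)) (Real.exp (x / 2) * (1 / 2)) x :=
    ((hasDerivAt_id x).div_const 2).exp
  have hfirst : deriv (fun x : ℝ => c * Real.exp (x / 2) + x / 2) =
      fun x => c * (Real.exp (x / 2) * (1 / 2)) + 1 / 2 :=
    funext fun x => (((hexp x).const_mul c).add ((hasDerivAt_id x).div_const 2)).deriv
  rw [hfirst]
  funext x
  rw [((((hexp x).mul_const (1 / 2)).const_mul c).add_const (1 / 2)).deriv]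
  ring

lemma tendsto_const_mul_exp_half_atTop {c : ℝ} (hc : 0 < c) :
    Tendsto (fun x : ℝ => c * Real.exp (x / 2)) atTop atTop :=
  (Real.tendsto_exp_atTop.comp (tendsto_id.atTop_div_const two_pos)).const_mul_atTop hc

lemma asympParabolic_const_mul_exp_half_add_half {c : ℝ} (hc : 0 < c) :
    AsympParabolic ⊥ (fun x : ℝ => c * Real.exp (x / 2) + x / 2) := by
  refine ⟨bot_lt_top, ContDiff.contDiffOn (by fun_prop), fun u _ => ?_, fun W hW ε hε => ?_⟩
  · rw [deriv_deriv_const_mul_exp_half_add_half]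
    positivity
  · rw [deriv_deriv_const_mul_exp_half_add_half]
    obtain ⟨δ, hδ, hexp⟩ := Metric.continuousAt_iff.1 (Real.continuous_exp.continuousAt (x := 0)) ε hε
    have hscale : Tendsto (fun u : ℝ => (c / 4 * Real.exp (u / 2)) ^ (-(1:ℝ)/2)) atTop (nhds 0) := by
      have := (tendsto_rpow_neg_atTop (y := 1 / 2) (by norm_num)).comp
        (tendsto_const_mul_exp_half_atTop (c := c / 4) (by positivity))
      simpa only [Function.comp_def, neg_div] using this
    obtain ⟨U, hU⟩ := eventually_atTop.1
      (hscale.eventually (gt_mem_nhds (show 0 < δ / W by positivity)))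
    refine ⟨U, fun u hu w hw => ?_⟩
    have hs := hU u hu
    have hs0 : 0 ≤ (c / 4 * Real.exp (u / 2)) ^ (-(1:ℝ)/2) := by positivity
    set s := (c / 4 * Real.exp (u / 2)) ^ (-(1:ℝ)/2)
    have hratio : c / 4 * Real.exp ((u + w * s) / 2) / (c / 4 * Real.exp (u / 2)) =
        Real.exp (w * s / 2) := by
      rw [add_div, Real.exp_add]
      field_simp
    have hsmall : |w * s / 2| < δ := by
      rw [abs_div, abs_mul, abs_of_nonneg hs0, abs_two]
      have h₁ : |w| * s ≤ W * s := by gcongr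
      rw [lt_div_iff₀ hW] at hs
      linarith
    have := hexp (x := w * s / 2) (by rwa [Real.dist_eq, sub_zero])
    rw [Real.dist_eq, Real.exp_zero] at this
    simpa only [hratio] using this

lemma admissibleAP_const_mul_exp_half_add_half {c : ℝ} (hc : 0 < c) :
    AdmissibleAP ⊥ (fun x : ℝ => c * Real.exp (x / 2) + x / 2) := by
  refine ⟨asympParabolic_const_mul_exp_half_add_half hc, ?_⟩
  have hexp : Tendsto (fun x : ℝ => c / 2 * (Real.exp (x / 2) / (x / 2) ^ 1)) atTop atTop :=
    ((Real.tendsto_exp_div_pow_atTop 1).comp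
      (tendsto_id.atTop_div_const two_pos)).const_mul_atTop (by positivity)
  refine (tendsto_atTop_add_const_right _ (1 / 2) hexp).congr' ?_
  filter_upwards [eventually_gt_atTop 0] with x hx
  field_simp

lemma measureReal_Ioi_mul_exp_sqrt_le {ν : Measure ℝ} {c : ℝ} (hc : 0 < c)
    (hint : Integrable (fun x => Real.exp (c * Real.sqrt x)) ν) (x : ℝ) :
    ν.real (Ioi x) * Real.exp (c * Real.sqrt x) ≤ ∫ y, Real.exp (c * Real.sqrt y) ∂ν := by
  have hmarkov := mul_meas_ge_le_integral_of_nonneg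
    (Eventually.of_forall fun y => (Real.exp_pos (c * Real.sqrt y)).le) hint
    (Real.exp (c * Real.sqrt x))
  refine le_trans ?_ hmarkov
  rw [mul_comm]
  gcongr
  · exact (hint.measure_ge_lt_top (Real.exp_pos _)).ne
  · intro y hy
    have hy' : x ≤ y := le_of_lt hy
    simp only [mem_ofPred_eq]
    gcongr

lemma isBoundedUnder_tail_of_integrable_exp_sqrt {ν : Measure ℝ} {c : ℝ} (hc : 0 < c)
    (hint : Integrable (fun x => Real.exp (c * Real.sqrt x)) ν) :
    IsBoundedUnder (· ≤ ·) atTop (fun x : ℝ =>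
      (ν (Ioi x)).toReal * Real.sqrt x * Real.exp (c / 2 * Real.sqrt x)) := by
  refine isBoundedUnder_of ⟨2 / c * ∫ y, Real.exp (c * Real.sqrt y) ∂ν, fun x => ?_⟩
  have hsqrt : Real.sqrt x ≤ 2 / c * Real.exp (c / 2 * Real.sqrt x) := by
    have := Real.add_one_le_exp (c / 2 * Real.sqrt x)
    calc Real.sqrt x = 2 / c * (c / 2 * Real.sqrt x) := by field_simp
      _ ≤ _ := by gcongr; linarith
  calc (ν (Ioi x)).toReal * Real.sqrt x * Real.exp (c / 2 * Real.sqrt x)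
      ≤ (ν (Ioi x)).toReal * (2 / c * Real.exp (c / 2 * Real.sqrt x)) *
          Real.exp (c / 2 * Real.sqrt x) := by gcongr
    _ = 2 / c * (ν.real (Ioi x) * Real.exp (c * Real.sqrt x)) := by
      rw [show c * Real.sqrt x = c / 2 * Real.sqrt x + c / 2 * Real.sqrt x by ring, Real.exp_add,
        Measure.real]
      ring
    _ ≤ _ := by
      gcongr
      exact measureReal_Ioi_mul_exp_sqrt_le hc hint x

lemma ofReal_exp_mul_sqrt_le_tsum {c : ℝ} (hc : 0 ≤ c) (x : ℝ) :
    ENNReal.ofReal (Real.exp (c * Real.sqrt x)) ≤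
      1 + ∑' n : ℕ, (Ioi ((n : ℝ) ^ 2)).indicator
        (fun _ => ENNReal.ofReal (Real.exp (c * (n + 1)))) x := by
  rcases le_or_gt x 0 with hx | hx
  · simp [Real.sqrt_eq_zero_of_nonpos hx]
  obtain ⟨n, hn⟩ : ∃ n, ⌈Real.sqrt x⌉₊ = n + 1 :=
    Nat.exists_eq_succ_of_ne_zero (Nat.ceil_pos.2 (Real.sqrt_pos.2 hx)).ne'
  have hlt : (n : ℝ) < Real.sqrt x := Nat.lt_ceil.1 (by lia)
  have hle : Real.sqrt x ≤ n + 1 := by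
    have := Nat.le_ceil (Real.sqrt x)
    rw [hn] at this
    exact_mod_cast this
  refine le_add_left (le_trans ?_ (ENNReal.le_tsum n))
  rw [indicator_of_mem (show x ∈ Ioi ((n : ℝ) ^ 2) from (Real.lt_sqrt n.cast_nonneg).1 hlt)]
  gcongr

lemma summable_exp_mul_tail {ν : Measure ℝ} {c : ℝ} (hc : 0 < c)
    (htail : IsBoundedUnder (· ≤ ·) atTop
      (fun x : ℝ => (ν (Ioi x)).toReal * Real.sqrt x * Real.exp (c * Real.sqrt x))) :
    Summable fun n : ℕ => Real.exp (c / 2 * (n + 1)) * (ν (Ioi ((n : ℝ) ^ 2))).toReal := by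
  obtain ⟨K, hK⟩ := htail
  rw [eventually_map] at hK
  have hsq : Tendsto (fun n : ℕ => (n : ℝ) ^ 2) atTop atTop :=
    (tendsto_pow_atTop two_ne_zero).comp tendsto_natCast_atTop_atTop
  have hgeom : Summable fun n : ℕ => Real.exp (n * (-(c / 2))) :=
    Real.summable_exp_nat_mul_iff.2 (by linarith)
  refine (hgeom.mul_left (K * Real.exp (c / 2))).of_norm_bounded_eventually_nat ?_
  filter_upwards [hsq.eventually hK, eventually_ge_atTop 1] with n hn hn1
  rw [Real.sqrt_sq n.cast_nonneg] at hn
  have hn1' : (1 : ℝ) ≤ n := by exact_mod_cast hn1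
  rw [Real.norm_of_nonneg (by positivity)]
  have hbound : (ν (Ioi ((n : ℝ) ^ 2))).toReal * Real.exp (c * n) ≤ K := by
    refine le_trans ?_ hn
    gcongr
    exact le_mul_of_one_le_right ENNReal.toReal_nonneg hn1'
  calc Real.exp (c / 2 * (n + 1)) * (ν (Ioi ((n : ℝ) ^ 2))).toReal
      = (ν (Ioi ((n : ℝ) ^ 2))).toReal * Real.exp (c * n) * Real.exp (c / 2) *
          Real.exp (n * (-(c / 2))) := by
        rw [mul_comm, mul_assoc, mul_assoc, ← Real.exp_add, ← Real.exp_add]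
        ring_nf
    _ ≤ K * Real.exp (c / 2) * Real.exp (n * (-(c / 2))) := by gcongr

lemma integrable_exp_sqrt_of_isBoundedUnder_tail {ν : Measure ℝ} [IsFiniteMeasure ν] {c : ℝ}
    (hc : 0 < c) (htail : IsBoundedUnder (· ≤ ·) atTop
      (fun x : ℝ => (ν (Ioi x)).toReal * Real.sqrt x * Real.exp (c * Real.sqrt x))) :
    Integrable (fun x => Real.exp (c / 2 * Real.sqrt x)) ν := by
  have hmeas (n : ℕ) : Measurable ((Ioi ((n : ℝ) ^ 2)).indicator
      fun _ : ℝ => ENNReal.ofReal (Real.exp (c / 2 * (n + 1)))) :=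
    measurable_const.indicator measurableSet_Ioi
  have hcont : Continuous fun x => Real.exp (c / 2 * Real.sqrt x) := by fun_prop
  refine ⟨hcont.aestronglyMeasurable, ?_⟩
  rw [hasFiniteIntegral_iff_ofReal (Eventually.of_forall fun x => (Real.exp_pos _).le)]
  refine (lintegral_mono fun x => ofReal_exp_mul_sqrt_le_tsum (by positivity) x).trans_lt ?_
  rw [lintegral_add_left measurable_const, lintegral_tsum fun n => (hmeas n).aemeasurable]
  refine ENNReal.add_lt_top.2 ⟨by simp, lt_of_eq_of_lt (tsum_congr fun n => ?_)
    (summable_exp_mul_tail hc htail).tsum_ofReal_lt_top⟩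
  rw [lintegral_indicator_const measurableSet_Ioi, ENNReal.ofReal_mul (Real.exp_pos _).le,
    ENNReal.ofReal_toReal (measure_ne_top _ _)]

/-- **Corollary 1.5(1)**: Hardy's condition `∫ e^{c√x} dν < ∞` holds for some `c > 0` iff
the tail satisfies `ν((x,∞)) = O(e^{-c√x - (1/2)log x})` for some `c > 0`; moreover for
every `c > 0` the function `x ↦ c e^{x/2} + x/2` is admissible asymptotically parabolic. -/
theorem hardy_condition_iff_tail
    (ν : Measure ℝ) [IsProbabilityMeasure ν] (hν0 : ν (Iio (0:ℝ)) = 0)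
    (hmom : ∀ n : ℕ, Integrable (fun x => x ^ n) ν) :
    ((∃ c : ℝ, 0 < c ∧ Integrable (fun x => Real.exp (c * Real.sqrt x)) ν) ↔
      (∃ c : ℝ, 0 < c ∧ IsBoundedUnder (· ≤ ·) atTop
        (fun x : ℝ => (ν (Ioi x)).toReal * Real.sqrt x * Real.exp (c * Real.sqrt x)))) ∧
    (∀ c : ℝ, 0 < c →
      AdmissibleAP (⊥ : EReal) (fun x : ℝ => c * Real.exp (x / 2) + x / 2)) := by
  refine ⟨⟨?_, ?_⟩, fun c hc => admissibleAP_const_mul_exp_half_add_half hc⟩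
  · rintro ⟨c, hc, hint⟩
    exact ⟨c / 2, half_pos hc, isBoundedUnder_tail_of_integrable_exp_sqrt hc hint⟩
  · rintro ⟨c, hc, htail⟩
    exact ⟨c / 2, half_pos hc, integrable_exp_sqrt_of_isBoundedUnder_tail hc htail⟩
end
end

section
/- Let α > 0 and let ν be a probability measure on [0,∞) with support equal to [0,∞), absolutely continuous with density f, and suppose there exist constants C ≥ 1 and A > e such that C^{−1}·exp(−α√x/log x) ≤ f(x) ≤ C·exp(−α√x/log x) for all x ≥ A. Then ν does not satisfy Hardy's condition, i.e. ∫₀^∞ e^{c√x} f(x) dx = ∞ for every c > 0, yet all positive moments of ν are finite and ν is moment determinate. -/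
open MeasureTheory Set Filter

noncomputable section

/-- Growth of a flat function: a bound at stage `N + 1` at the point `x` degrades by at most one
stage over an interval of length `(e * r N)⁻¹`. -/
lemma norm_le_exp_mul_of_stage {E : Type*} [NormedAddCommGroup E] [NormedSpace ℝ E]
    {F : ℕ → ℝ → E} {M r : ℕ → ℝ}
    (hF : ∀ n t, HasDerivAt (F n) (F (n + 1) t) t) (hFM : ∀ n t, ‖F n t‖ ≤ M n)
    (hM : ∀ n, M (n + 1) = r n * M n) (hr : Monotone r) (hr0 : ∀ n, 0 < r n) (N : ℕ) {x s : ℝ}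
    (hx : ∀ j ≤ N, ‖F j x‖ ≤ Real.exp (j - (N + 1)) * M j) (hs : 0 ≤ s)
    (hs1 : Real.exp 1 * r N * s ≤ 1) {j : ℕ} (hj : j ≤ N) :
    ‖F j (x + s)‖ ≤ Real.exp (j - N) * M j := by
  have hM0 : ∀ n, 0 ≤ M n := fun n => (norm_nonneg _).trans (hFM n 0)
  have key : ∀ j ≤ N + 1, ∀ s : ℝ, 0 ≤ s →
      ‖F j (x + s)‖ ≤ Real.exp (j - (N + 1)) * M j * Real.exp (Real.exp 1 * r N * s) := by
    intro j hj
    induction hj using Nat.decreasingInduction with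
    | self =>
      intro s hs
      have h1 : 1 ≤ Real.exp (Real.exp 1 * r N * s) :=
        Real.one_le_exp (by have := hr0 N; positivity)
      calc ‖F (N + 1) (x + s)‖ ≤ M (N + 1) * 1 := by simpa using hFM (N + 1) (x + s)
        _ ≤ M (N + 1) * Real.exp (Real.exp 1 * r N * s) :=
          mul_le_mul_of_nonneg_left h1 (hM0 _)
        _ = _ := by simp
    | of_succ k hk ih =>
      intro s hs
      have hd : ∀ u : ℝ, HasDerivAt (fun u => F k (x + u)) (F (k + 1) (x + u)) u := fun u => by
        simpa using (hF k (x + u)).comp_const_add x u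
      have hB : ∀ u : ℝ, HasDerivAt
          (fun u => Real.exp (k - (N + 1)) * M k * Real.exp (Real.exp 1 * r N * u))
          (Real.exp (k - (N + 1)) * M k *
            (Real.exp (Real.exp 1 * r N * u) * (Real.exp 1 * r N))) u := fun u => by
        have := ((hasDerivAt_id u).const_mul (Real.exp 1 * r N)).exp
        simpa using this.const_mul (Real.exp (k - (N + 1)) * M k)
      refine image_norm_le_of_norm_deriv_right_le_deriv_boundary
        (f := fun u => F k (x + u)) (f' := fun u => F (k + 1) (x + u)) (a := 0) (b := s)
        (fun u _ => (hd u).continuousAt.continuousWithinAt)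
        (fun u _ => (hd u).hasDerivWithinAt) ?_ hB ?_ (right_mem_Icc.2 hs)
      · simpa using hx k (by omega)
      · intro u hu
        refine (ih u hu.1).trans ?_
        rw [hM k]
        have e1 : Real.exp (((k + 1 : ℕ) : ℝ) - (N + 1))
            = Real.exp (k - (N + 1)) * Real.exp 1 := by
          rw [← Real.exp_add]; push_cast; ring_nf
        rw [e1]
        have h1 : r k * M k ≤ r N * M k :=
          mul_le_mul_of_nonneg_right (hr (by omega)) (hM0 k)
        calc _ ≤ Real.exp (k - (N + 1)) * Real.exp 1 * (r N * M k)
              * Real.exp (Real.exp 1 * r N * u) := by gcongr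
          _ = _ := by ring
  calc ‖F j (x + s)‖
      ≤ Real.exp (j - (N + 1)) * M j * Real.exp (Real.exp 1 * r N * s) := key j (by omega) s hs
    _ ≤ Real.exp (j - (N + 1)) * M j * Real.exp 1 := by
        have := hM0 j
        gcongr
    _ = Real.exp (j - N) * M j := by
        rw [mul_right_comm, ← Real.exp_add]; ring_nf

/-- Bang's form of the Denjoy–Carleman theorem on the half-line. -/
theorem eq_zero_of_flat_of_not_summable {E : Type*} [NormedAddCommGroup E] [NormedSpace ℝ E]
    {F : ℕ → ℝ → E} {M r : ℕ → ℝ}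
    (hF : ∀ n t, HasDerivAt (F n) (F (n + 1) t) t) (hFM : ∀ n t, ‖F n t‖ ≤ M n)
    (hM : ∀ n, M (n + 1) = r n * M n) (hr : Monotone r) (hr0 : ∀ n, 0 < r n)
    (hsum : ¬ Summable fun n => (r n)⁻¹) (h0 : ∀ n, F n 0 = 0) {t : ℝ} (ht : 0 ≤ t) :
    F 0 t = 0 := by
  have hM0 : ∀ n, 0 ≤ M n := fun n => (norm_nonneg _).trans (hFM n 0)
  have key : ∀ d K : ℕ, ∀ x : ℝ, 0 ≤ x →
      x ≤ ∑ n ∈ Finset.range d, (Real.exp 1 * r (K + n))⁻¹ →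
      ∀ j ≤ K, ‖F j x‖ ≤ Real.exp (j - K) * M j := by
    intro d
    induction d with
    | zero =>
      intro K x hx hx' j _
      obtain rfl : x = 0 := le_antisymm (by simpa using hx') hx
      simpa [h0] using mul_nonneg (Real.exp_nonneg _) (hM0 j)
    | succ d ih =>
      intro K x hx hx' j hj
      rw [Finset.sum_range_succ'] at hx'
      set S := ∑ n ∈ Finset.range d, (Real.exp 1 * r (K + (n + 1)))⁻¹ with hS
      have hS0 : 0 ≤ S := Finset.sum_nonneg fun n _ => by have := hr0 (K + (n + 1)); positivity
      have hy := ih (K + 1) (min x S) (le_min hx hS0) ((min_le_right _ _).trans_eq (by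
        rw [hS]; refine Finset.sum_congr rfl fun n _ => ?_
        rw [add_assoc, add_comm 1 n]))
      have hc : 0 < Real.exp 1 * r K := by have := hr0 K; positivity
      have hstep : x - min x S ≤ (Real.exp 1 * r K)⁻¹ := by
        rcases min_cases x S with ⟨h, _⟩ | ⟨h, _⟩
        · rw [h, sub_self]; positivity
        · rw [h]; simp only [add_zero] at hx'; linarith
      have := norm_le_exp_mul_of_stage hF hFM hM hr hr0 K (x := min x S) (s := x - min x S)
        (fun j hj => by simpa using hy j (by omega)) (sub_nonneg.2 (min_le_left _ _))
        (by
          calc _ ≤ Real.exp 1 * r K * (Real.exp 1 * r K)⁻¹ := by gcongr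
            _ = 1 := mul_inv_cancel₀ hc.ne') hj
      simpa using this
  have hK : ∀ K : ℕ, ‖F 0 t‖ ≤ Real.exp (-K) * M 0 := by
    intro K
    have hns : ¬ Summable fun n => (Real.exp 1 * r (K + n))⁻¹ := by
      intro h
      apply hsum
      have h2 := h.mul_left (Real.exp 1)
      refine (summable_nat_add_iff K).1 (h2.congr fun n => ?_)
      rw [add_comm K n, mul_inv, ← mul_assoc, mul_inv_cancel₀ (Real.exp_ne_zero _), one_mul]
    have htend := (not_summable_iff_tendsto_nat_atTop_of_nonneg (fun n => by
      have := hr0 (K + n); positivity)).1 hns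
    obtain ⟨d, hd⟩ := (htend.eventually_ge_atTop t).exists
    simpa using key d K t ht hd 0 (Nat.zero_le _)
  have hlim : Tendsto (fun K : ℕ => Real.exp (-K) * M 0) atTop (nhds 0) := by
    have := (Real.tendsto_exp_neg_atTop_nhds_zero.comp tendsto_natCast_atTop_atTop).mul_const (M 0)
    simpa using this
  exact norm_le_zero_iff.1 (ge_of_tendsto' hlim hK)

open scoped ContDiff in
/-- Finite measures on the line with the same moments coincide if the absolute moments are
bounded by a quasianalytic sequence. -/
theorem measure_eq_of_moments_eq_of_not_summable {μ ν : Measure ℝ}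
    [IsFiniteMeasure μ] [IsFiniteMeasure ν] {M r : ℕ → ℝ}
    (hμ : ∀ n : ℕ, Integrable (fun x => |x| ^ n) μ) (hν : ∀ n : ℕ, Integrable (fun x => |x| ^ n) ν)
    (hμM : ∀ n : ℕ, ∫ x, |x| ^ n ∂μ ≤ M n) (hνM : ∀ n : ℕ, ∫ x, |x| ^ n ∂ν ≤ M n)
    (hM : ∀ n, M (n + 1) = r n * M n) (hr : Monotone r) (hr0 : ∀ n, 0 < r n)
    (hsum : ¬ Summable fun n => (r n)⁻¹)
    (hmom : ∀ n : ℕ, ∫ x, x ^ n ∂μ = ∫ x, x ^ n ∂ν) : μ = ν := by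
  have memLp : ∀ ρ : Measure ℝ, (∀ n : ℕ, Integrable (fun x => |x| ^ n) ρ) →
      ∀ n : ℕ, MemLp id n ρ := by
    intro ρ h n
    rcases eq_or_ne n 0 with rfl | hn
    · simpa using aestronglyMeasurable_id
    · refine (integrable_norm_rpow_iff (f := id) aestronglyMeasurable_id
        (by exact_mod_cast hn) (ENNReal.natCast_ne_top n)).1 ?_
      simpa using h n
  have hμ' := memLp μ hμ
  have hν' := memLp ν hν
  have hcμ : ContDiff ℝ ∞ (charFun μ) := contDiff_charFun' hμ'
  have hcν : ContDiff ℝ ∞ (charFun ν) := contDiff_charFun' hν'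
  have hderiv : ∀ φ : ℝ → ℂ, ContDiff ℝ ∞ φ → ∀ n t,
      HasDerivAt (iteratedDeriv n φ) (iteratedDeriv (n + 1) φ t) t := fun φ hφ n t => by
    rw [iteratedDeriv_succ]
    exact ((hφ.differentiable_iteratedDeriv n
      (by exact_mod_cast WithTop.coe_lt_top n)) t).hasDerivAt
  have hnorm : ∀ (ρ : Measure ℝ) [IsFiniteMeasure ρ], (∀ n : ℕ, MemLp id n ρ) →
      (∀ n : ℕ, ∫ x, |x| ^ n ∂ρ ≤ M n) → ∀ (n : ℕ) (t : ℝ),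
      ‖iteratedDeriv n (charFun ρ) t‖ ≤ M n := by
    intro ρ _ hρ hρM n t
    rw [iteratedDeriv_charFun (hρ n), norm_mul, norm_pow, Complex.norm_I, one_pow, one_mul]
    refine (norm_integral_le_integral_norm _).trans (le_of_eq_of_le ?_ (hρM n))
    refine integral_congr_ae (ae_of_all _ fun x => ?_)
    have : ‖Complex.exp (t * x * Complex.I)‖ = 1 := by
      exact_mod_cast Complex.norm_exp_ofReal_mul_I (t * x)
    simp [this]
  have hpos : ∀ t : ℝ, 0 ≤ t → charFun μ t = charFun ν t := by
    intro t ht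
    have := eq_zero_of_flat_of_not_summable
      (F := fun n t => iteratedDeriv n (charFun μ) t - iteratedDeriv n (charFun ν) t)
      (M := fun n => 2 * M n) (r := r)
      (fun n t => (hderiv _ hcμ n t).sub (hderiv _ hcν n t))
      (fun n t => (norm_sub_le _ _).trans (by
        linarith [hnorm μ hμ' hμM n t, hnorm ν hν' hνM n t]))
      (fun n => by simp only [hM n]; ring) hr hr0 hsum
      (fun n => by
        simp only [iteratedDeriv_charFun_zero (hμ' n), iteratedDeriv_charFun_zero (hν' n), hmom n,
          sub_self]) ht
    simpa [sub_eq_zero] using this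
  refine Measure.ext_of_charFun (funext fun t => ?_)
  rcases le_total 0 t with ht | ht
  · exact hpos t ht
  · have := hpos (-t) (by linarith)
    rw [charFun_neg, charFun_neg] at this
    exact star_injective this

/-- The even measure on the line whose image under squaring is `2 • μ`, for `μ` on `[0, ∞)`. -/
def sqrtSymm (μ : Measure ℝ) : Measure ℝ := μ.map Real.sqrt + μ.map (fun x => -Real.sqrt x)

lemma map_sq_sqrtSymm {μ : Measure ℝ} (hμ : μ (Iio 0) = 0) :
    (sqrtSymm μ).map (fun x => x ^ 2) = μ + μ := by
  have hnn : ∀ᵐ x ∂μ, 0 ≤ x := by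
    simpa [ae_iff, Iio] using hμ
  have h1 : μ.map (fun x => Real.sqrt x ^ 2) = μ := by
    conv_rhs => rw [← Measure.map_id (μ := μ)]
    exact Measure.map_congr (hnn.mono fun x hx => Real.sq_sqrt hx)
  rw [sqrtSymm, Measure.map_add _ _ (by fun_prop), Measure.map_map (by fun_prop) (by fun_prop),
    Measure.map_map (by fun_prop) (by fun_prop)]
  simp only [Function.comp_def, neg_sq, h1]

lemma eq_of_sqrtSymm_eq {μ ν : Measure ℝ} [IsFiniteMeasure μ] [IsFiniteMeasure ν]
    (hμ : μ (Iio 0) = 0) (hν : ν (Iio 0) = 0)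
    (h : sqrtSymm μ = sqrtSymm ν) : μ = ν := by
  have h2 : μ + μ = ν + ν := by rw [← map_sq_sqrtSymm hμ, ← map_sq_sqrtSymm hν, h]
  ext s _
  have h3 : μ s + μ s = ν s + ν s := by
    rw [← Measure.add_apply, h2, Measure.add_apply]
  have h4 := congrArg ENNReal.toReal h3
  rw [ENNReal.toReal_add (measure_ne_top _ _) (measure_ne_top _ _),
    ENNReal.toReal_add (measure_ne_top _ _) (measure_ne_top _ _)] at h4
  exact (ENNReal.toReal_eq_toReal_iff' (measure_ne_top _ _) (measure_ne_top _ _)).1 (by linarith)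

instance (μ : Measure ℝ) [IsFiniteMeasure μ] : IsFiniteMeasure (sqrtSymm μ) := by
  unfold sqrtSymm; infer_instance

lemma integrable_sqrtSymm {μ : Measure ℝ} {g : ℝ → ℝ} (hg : Continuous g)
    (h1 : Integrable (fun x => g (Real.sqrt x)) μ)
    (h2 : Integrable (fun x => g (-Real.sqrt x)) μ) : Integrable g (sqrtSymm μ) :=
  ((integrable_map_measure hg.aestronglyMeasurable (by fun_prop)).2 h1).add_measure
    ((integrable_map_measure hg.aestronglyMeasurable (by fun_prop)).2 h2)

lemma integral_sqrtSymm {μ : Measure ℝ} {g : ℝ → ℝ} (hg : Continuous g)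
    (h1 : Integrable (fun x => g (Real.sqrt x)) μ)
    (h2 : Integrable (fun x => g (-Real.sqrt x)) μ) :
    ∫ x, g x ∂(sqrtSymm μ) = ∫ x, g (Real.sqrt x) ∂μ + ∫ x, g (-Real.sqrt x) ∂μ := by
  rw [sqrtSymm, integral_add_measure
    ((integrable_map_measure hg.aestronglyMeasurable (by fun_prop)).2 h1)
    ((integrable_map_measure hg.aestronglyMeasurable (by fun_prop)).2 h2),
    integral_map (by fun_prop) hg.aestronglyMeasurable,
    integral_map (by fun_prop) hg.aestronglyMeasurable]

/-- Half-integer moments of a measure on `[0, ∞)`, bounded by means of the integer ones. -/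
lemma integral_sqrt_pow_le {μ : Measure ℝ} (hμ : μ (Iio 0) = 0)
    (hint : ∀ n : ℕ, Integrable (fun x => x ^ n) μ) {M r : ℕ → ℝ} {c : ℝ}
    (hM : ∀ n, M (n + 1) = r n * M n) (hr0 : ∀ n, 0 < r n) (hM0 : ∀ n, 0 ≤ M n) (hc : 0 ≤ c)
    (hrc : ∀ n, r (n + 1) ≤ c * r n)
    (hμM : ∀ n : ℕ, ∫ x, x ^ n ∂μ ≤ M (2 * n)) (n : ℕ) :
    Integrable (fun x => Real.sqrt x ^ n) μ ∧ ∫ x, Real.sqrt x ^ n ∂μ ≤ (1 + c) * M n := by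
  have hnn : ∀ᵐ x ∂μ, 0 ≤ x := by
    simpa [ae_iff, Iio] using hμ
  have heven : ∀ k : ℕ, (fun x => Real.sqrt x ^ (2 * k)) =ᵐ[μ] fun x => x ^ k := fun k =>
    hnn.mono fun x hx => by simp only [pow_mul, Real.sq_sqrt hx]
  rcases Nat.even_or_odd' n with ⟨k, rfl | rfl⟩
  · refine ⟨(hint k).congr (heven k).symm, ?_⟩
    rw [integral_congr_ae (heven k)]
    nlinarith [hμM k, mul_nonneg hc (hM0 (2 * k))]
  · set a := r (2 * k) with ha
    have ha0 : 0 < a := hr0 _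
    have hg : Integrable (fun x => a * x ^ k + a⁻¹ * x ^ (k + 1)) μ :=
      ((hint k).const_mul a).add ((hint (k + 1)).const_mul a⁻¹)
    have hle : (fun x => Real.sqrt x ^ (2 * k + 1)) ≤ᵐ[μ]
        fun x => a * x ^ k + a⁻¹ * x ^ (k + 1) := by
      filter_upwards [hnn] with x hx
      have hs : Real.sqrt x ≤ a + a⁻¹ * x := by
        have h1 : 0 ≤ a⁻¹ * (Real.sqrt x - a) ^ 2 := by positivity
        have h2 : a⁻¹ * (Real.sqrt x - a) ^ 2 = a⁻¹ * x - 2 * Real.sqrt x + a := by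
          have := Real.sq_sqrt hx
          field_simp
          linear_combination this
        linarith [Real.sqrt_nonneg x]
      calc Real.sqrt x ^ (2 * k + 1) = x ^ k * Real.sqrt x := by
            rw [pow_succ, pow_mul, Real.sq_sqrt hx]
        _ ≤ x ^ k * (a + a⁻¹ * x) := by gcongr
        _ = _ := by ring
    have hI : Integrable (fun x => Real.sqrt x ^ (2 * k + 1)) μ :=
      hg.mono' (by fun_prop) (hle.mono fun x hx => by
        rwa [Real.norm_of_nonneg (by positivity)])
    refine ⟨hI, (integral_mono_ae hI hg hle).trans ?_⟩
    rw [integral_add ((hint k).const_mul a) ((hint (k + 1)).const_mul a⁻¹),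
      integral_const_mul, integral_const_mul]
    have h1 : a * ∫ x, x ^ k ∂μ ≤ M (2 * k + 1) := by
      rw [hM (2 * k)]; exact mul_le_mul_of_nonneg_left (hμM k) ha0.le
    have h2 : a⁻¹ * ∫ x, x ^ (k + 1) ∂μ ≤ c * M (2 * k + 1) := by
      have h3 : ∫ x, x ^ (k + 1) ∂μ ≤ c * a * M (2 * k + 1) :=
        (hμM (k + 1)).trans (by
          rw [show 2 * (k + 1) = 2 * k + 1 + 1 by ring, hM (2 * k + 1)]
          exact mul_le_mul_of_nonneg_right (hrc _) (hM0 _))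
      calc _ ≤ a⁻¹ * (c * a * M (2 * k + 1)) := by gcongr
        _ = _ := by field_simp
    linarith

/-- A Carleman-type criterion for the Stieltjes problem: measures on `[0, ∞)` with the same
moments coincide if the moments are bounded by a regular quasianalytic sequence. -/
theorem measure_eq_of_stieltjes_moments_eq {μ ν : Measure ℝ}
    (hμ : μ (Iio 0) = 0) (hν : ν (Iio 0) = 0)
    (hμi : ∀ n : ℕ, Integrable (fun x => x ^ n) μ) (hνi : ∀ n : ℕ, Integrable (fun x => x ^ n) ν)
    {M r : ℕ → ℝ} {c : ℝ}
    (hM : ∀ n, M (n + 1) = r n * M n) (hr : Monotone r) (hr0 : ∀ n, 0 < r n)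
    (hM0 : ∀ n, 0 ≤ M n) (hc : 0 ≤ c) (hrc : ∀ n, r (n + 1) ≤ c * r n)
    (hsum : ¬ Summable fun n => (r n)⁻¹)
    (hνM : ∀ n : ℕ, ∫ x, x ^ n ∂ν ≤ M (2 * n))
    (hmom : ∀ n : ℕ, ∫ x, x ^ n ∂μ = ∫ x, x ^ n ∂ν) : μ = ν := by
  have finite : ∀ ρ : Measure ℝ, (∀ n : ℕ, Integrable (fun x => x ^ n) ρ) → IsFiniteMeasure ρ :=
    fun ρ h => by
      have := h 0
      simp only [pow_zero] at this
      exact (integrable_const_iff_isFiniteMeasure one_ne_zero).1 this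
  have := finite μ hμi
  have := finite ν hνi
  have sqμ := integral_sqrt_pow_le hμ hμi hM hr0 hM0 hc hrc (fun n => (hmom n).trans_le (hνM n))
  have sqν := integral_sqrt_pow_le hν hνi hM hr0 hM0 hc hrc hνM
  have abs_int : ∀ ρ : Measure ℝ, (∀ n : ℕ, Integrable (fun x => Real.sqrt x ^ n) ρ) → ∀ n : ℕ,
      Integrable (fun x => |x| ^ n) (sqrtSymm ρ) ∧
      ∫ x, |x| ^ n ∂(sqrtSymm ρ) = 2 * ∫ x, Real.sqrt x ^ n ∂ρ := by
    intro ρ h n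
    have h1 : Integrable (fun x => |Real.sqrt x| ^ n) ρ := by
      simpa only [abs_of_nonneg (Real.sqrt_nonneg _)] using h n
    have h2 : Integrable (fun x => |-Real.sqrt x| ^ n) ρ := by simpa only [abs_neg] using h1
    refine ⟨integrable_sqrtSymm (g := fun x => |x| ^ n) (by fun_prop) h1 h2, ?_⟩
    rw [integral_sqrtSymm (g := fun x => |x| ^ n) (by fun_prop) h1 h2]
    simp only [abs_neg, abs_of_nonneg (Real.sqrt_nonneg _)]
    ring
  have pow_int : ∀ ρ : Measure ℝ, (∀ n : ℕ, Integrable (fun x => Real.sqrt x ^ n) ρ) → ∀ n : ℕ,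
      ∫ x, x ^ n ∂(sqrtSymm ρ) = (1 + (-1) ^ n) * ∫ x, Real.sqrt x ^ n ∂ρ := by
    intro ρ h n
    have e : (fun x => (-Real.sqrt x) ^ n) = fun x => (-1) ^ n * Real.sqrt x ^ n :=
      funext fun x => neg_pow _ _
    rw [integral_sqrtSymm (g := fun x => x ^ n) (by fun_prop) (h n)
      (by rw [e]; exact (h n).const_mul _), e, integral_const_mul]
    ring
  have even_int : ∀ ρ : Measure ℝ, ρ (Iio 0) = 0 → ∀ k : ℕ,
      ∫ x, Real.sqrt x ^ (2 * k) ∂ρ = ∫ x, x ^ k ∂ρ := by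
    intro ρ hρ k
    have hnn : ∀ᵐ x ∂ρ, 0 ≤ x := by simpa [ae_iff, Iio] using hρ
    exact integral_congr_ae (hnn.mono fun x hx => by simp only [pow_mul, Real.sq_sqrt hx])
  have iμ := abs_int μ fun n => (sqμ n).1
  have iν := abs_int ν fun n => (sqν n).1
  refine eq_of_sqrtSymm_eq hμ hν (measure_eq_of_moments_eq_of_not_summable
    (M := fun n => 2 * ((1 + c) * M n)) (r := r)
    (fun n => (iμ n).1) (fun n => (iν n).1)
    (fun n => by linarith [(iμ n).2, (sqμ n).2]) (fun n => by linarith [(iν n).2, (sqν n).2])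
    (fun n => by simp only [hM n]; ring) hr hr0 hsum fun n => ?_)
  rw [pow_int μ (fun n => (sqμ n).1), pow_int ν (fun n => (sqν n).1)]
  rcases Nat.even_or_odd' n with ⟨k, rfl | rfl⟩
  · rw [even_int μ hμ, even_int ν hν, hmom]
  · simp [pow_succ, pow_mul]

/-- The ratios `(n + 1) log (n + 3)` of a borderline quasianalytic sequence. -/
def logRatio (n : ℕ) : ℝ := (n + 1) * Real.log (n + 3)

lemma one_le_log_natCast_add_three (n : ℕ) : 1 ≤ Real.log (n + 3) := by
  rw [Real.le_log_iff_exp_le (by positivity)]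
  have := Real.exp_one_lt_d9
  have : (0 : ℝ) ≤ n := n.cast_nonneg
  linarith

lemma one_le_logRatio (n : ℕ) : 1 ≤ logRatio n := by
  have h1 := one_le_log_natCast_add_three n
  have h2 : (1 : ℝ) ≤ n + 1 := by have : (0 : ℝ) ≤ n := n.cast_nonneg
                                  linarith
  unfold logRatio
  nlinarith

lemma monotone_logRatio : Monotone logRatio := by
  intro m n h
  have h' : (m : ℝ) ≤ n := by exact_mod_cast h
  have h1 := one_le_log_natCast_add_three m
  unfold logRatio
  gcongr

lemma logRatio_succ_le (n : ℕ) : logRatio (n + 1) ≤ 4 * logRatio n := by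
  have hn : (0 : ℝ) ≤ n := n.cast_nonneg
  have h1 := one_le_log_natCast_add_three n
  have h2 : Real.log (n + 1 + 3) ≤ 2 * Real.log (n + 3) := by
    have h3 : 2 * Real.log ((n : ℝ) + 3) = Real.log ((n + 3) ^ 2) := by
      rw [Real.log_pow]; norm_num
    rw [h3]
    exact Real.log_le_log (by positivity) (by nlinarith)
  unfold logRatio
  push_cast
  calc ((n : ℝ) + 1 + 1) * Real.log (n + 1 + 3) ≤ (n + 1 + 1) * (2 * Real.log (n + 3)) := by gcongr
    _ ≤ (2 * (n + 1)) * (2 * Real.log (n + 3)) := by gcongr; linarith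
    _ = _ := by ring

lemma not_summable_inv_logRatio : ¬ Summable fun n => (logRatio n)⁻¹ := by
  have hpos : ∀ n, 0 < logRatio n := fun n => one_pos.trans_le (one_le_logRatio n)
  rw [← summable_condensed_iff_of_nonneg (fun n => (inv_pos.2 (hpos n)).le)
    (fun m n _ h => inv_anti₀ (hpos m) (monotone_logRatio h))]
  intro h
  have h2 : Summable fun k : ℕ => (((k + 2 : ℕ) : ℝ))⁻¹ := by
    refine (h.mul_left 2).of_nonneg_of_le (fun k => by positivity) fun k => ?_
    have h1 : (1 : ℝ) ≤ 2 ^ k := one_le_pow₀ one_le_two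
    have hlog : Real.log (2 ^ k + 3) ≤ k + 2 := by
      calc Real.log (2 ^ k + 3) ≤ Real.log (2 ^ (k + 2)) :=
            Real.log_le_log (by positivity) (by rw [pow_add]; linarith)
        _ = (k + 2) * Real.log 2 := by rw [Real.log_pow]; push_cast; ring
        _ ≤ (k + 2) * 1 := by
            have := Real.log_two_lt_d9
            gcongr
            linarith
        _ = _ := by ring
    have hr : logRatio (2 ^ k) ≤ 2 * 2 ^ k * (k + 2) := by
      unfold logRatio
      push_cast
      have := one_le_log_natCast_add_three (2 ^ k)
      push_cast at this
      gcongr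
      linarith
    calc ((k + 2 : ℕ) : ℝ)⁻¹ = 2 * (2 ^ k * (2 * 2 ^ k * (k + 2) : ℝ)⁻¹) := by
          push_cast; field_simp
      _ ≤ 2 * (2 ^ k * (logRatio (2 ^ k))⁻¹) := by
          gcongr
          exact hpos _
  exact Real.not_summable_natCast_inv ((summable_nat_add_iff 2).1 h2)

lemma factorial_mul_log_pow_le (n : ℕ) :
    (n.factorial : ℝ) * Real.log (n + 3) ^ n ≤
      Real.exp 1 ^ n * ∏ k ∈ Finset.range n, logRatio k := by
  induction n with
  | zero => simp
  | succ n ih =>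
    have hn : (0 : ℝ) ≤ n := n.cast_nonneg
    have h1 := one_le_log_natCast_add_three n
    have hlog : Real.log (n + 1 + 3) ≤ Real.log (n + 3) * Real.exp ((n + 3)⁻¹ : ℝ) := by
      have h2 : Real.log (n + 1 + 3) ≤ Real.log (n + 3) + (n + 3 : ℝ)⁻¹ := by
        have h3 : ((n : ℝ) + 1 + 3) = (n + 3) * (1 + (n + 3 : ℝ)⁻¹) := by field_simp; ring
        rw [h3, Real.log_mul (by positivity) (by positivity)]
        have := Real.log_le_sub_one_of_pos (x := 1 + (n + 3 : ℝ)⁻¹) (by positivity)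
        linarith
      have h4 := Real.add_one_le_exp ((n + 3 : ℝ)⁻¹)
      have h5 : (0 : ℝ) ≤ (n + 3 : ℝ)⁻¹ := by positivity
      nlinarith
    have hlog0 : 0 ≤ Real.log (n + 1 + 3) := by
      have := one_le_log_natCast_add_three (n + 1)
      push_cast at this
      linarith
    have hexp : Real.exp ((n + 3)⁻¹ : ℝ) ^ (n + 1) ≤ Real.exp 1 := by
      rw [← Real.exp_nat_mul]
      refine Real.exp_le_exp.2 ?_
      push_cast
      rw [← div_eq_mul_inv, div_le_one (by positivity)]
      linarith
    have hprod : 0 ≤ ∏ k ∈ Finset.range n, logRatio k :=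
      Finset.prod_nonneg fun k _ => zero_le_one.trans (one_le_logRatio k)
    calc ((n + 1).factorial : ℝ) * Real.log ((n + 1 : ℕ) + 3) ^ (n + 1)
        ≤ ((n + 1).factorial : ℝ) * (Real.log (n + 3) * Real.exp ((n + 3)⁻¹ : ℝ)) ^ (n + 1) := by
          push_cast
          gcongr
      _ = (n.factorial * Real.log (n + 3) ^ n) * ((n + 1) * Real.log (n + 3)) *
            Real.exp ((n + 3)⁻¹ : ℝ) ^ (n + 1) := by
          rw [Nat.factorial_succ]; push_cast; ring
      _ ≤ (Real.exp 1 ^ n * ∏ k ∈ Finset.range n, logRatio k) * ((n + 1) * Real.log (n + 3)) *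
            Real.exp 1 := by gcongr
      _ = _ := by rw [Finset.prod_range_succ, logRatio]; ring

lemma exists_sqrt_mul_log_le {β : ℝ} (hβ : 0 < β) :
    ∃ B : ℝ, 0 ≤ B ∧ ∀ y : ℝ, 1 < y → Real.sqrt y * Real.log y ≤ B + β * y / Real.log y := by
  have ho := (isLittleO_log_rpow_rpow_atTop 2 (s := 1 / 2) (by norm_num)).bound hβ
  obtain ⟨Y, hY⟩ := eventually_atTop.1 ho
  refine ⟨Real.sqrt |Y| * Real.log (max 1 Y), by
    have := Real.log_nonneg (le_max_left 1 Y); positivity, fun y hy => ?_⟩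
  have hl : 0 < Real.log y := Real.log_pos hy
  have hB : 0 ≤ Real.sqrt |Y| * Real.log (max 1 Y) := by
    have := Real.log_nonneg (le_max_left 1 Y); positivity
  rcases le_total Y y with h | h
  · have h1 := hY y h
    rw [Real.norm_of_nonneg (by positivity), Real.norm_of_nonneg (by positivity),
      ← Real.sqrt_eq_rpow, Real.rpow_two] at h1
    have h2 : Real.sqrt y * Real.log y ≤ β * y / Real.log y := by
      rw [le_div_iff₀ hl]
      have h3 := Real.mul_self_sqrt (zero_le_one.trans hy.le)
      calc Real.sqrt y * Real.log y * Real.log y = Real.sqrt y * Real.log y ^ 2 := by ring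
        _ ≤ Real.sqrt y * (β * Real.sqrt y) := by gcongr
        _ = β * y := by linear_combination β * h3
    linarith
  · have h1 : Real.sqrt y ≤ Real.sqrt |Y| := Real.sqrt_le_sqrt (h.trans (le_abs_self _))
    have h2 : Real.log y ≤ Real.log (max 1 Y) :=
      Real.log_le_log (by linarith) (h.trans (le_max_right _ _))
    have h3 : 0 ≤ β * y / Real.log y := by positivity
    have h4 := mul_le_mul h1 h2 hl.le (Real.sqrt_nonneg _)
    linarith

lemma exists_pow_le_mul_exp_div_log {β D₀ : ℝ} (hβ : 0 < β) :
    ∃ K D : ℝ, 1 ≤ K ∧ 1 ≤ D ∧ D₀ ≤ D ∧ ∀ (n : ℕ) (y : ℝ), 1 < y →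
      y ^ n ≤ K * (∏ k ∈ Finset.range n, D * logRatio k) * Real.exp (β * y / Real.log y) := by
  obtain ⟨B, hB, hBy⟩ := exists_sqrt_mul_log_le hβ
  set D := max (max 1 D₀) (2 * Real.exp 1 / β) with hD
  have hD1 : 1 ≤ D := (le_max_left _ _).trans (le_max_left _ _)
  refine ⟨Real.exp B, D, Real.one_le_exp hB, hD1,
    (le_max_right _ _).trans (le_max_left _ _), fun n y hy => ?_⟩
  have hl : 0 < Real.log y := Real.log_pos hy
  have hy0 : 0 < y := one_pos.trans hy
  rcases le_total (Real.log y) (2 * Real.log (n + 3)) with h | h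
  · have h1 := Real.pow_div_factorial_le_exp (β * y / Real.log y) (by positivity) n
    rw [div_le_iff₀ (by positivity)] at h1
    have hprod : 0 ≤ ∏ k ∈ Finset.range n, logRatio k :=
      Finset.prod_nonneg fun k _ => zero_le_one.trans (one_le_logRatio k)
    calc y ^ n = (β * y / Real.log y) ^ n * (Real.log y / β) ^ n := by
          rw [← mul_pow]; congr 1; field_simp
      _ ≤ (Real.exp (β * y / Real.log y) * n.factorial) * (2 * Real.log (n + 3) / β) ^ n := by
          gcongr
      _ = (2 / β) ^ n * (n.factorial * Real.log (n + 3) ^ n) * Real.exp (β * y / Real.log y) := by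
          rw [mul_div_right_comm 2, mul_pow]; ring
      _ ≤ (2 / β) ^ n * (Real.exp 1 ^ n * ∏ k ∈ Finset.range n, logRatio k)
            * Real.exp (β * y / Real.log y) := by
          gcongr (2 / β) ^ n * ?_ * _
          exact factorial_mul_log_pow_le n
      _ = 1 * ((2 * Real.exp 1 / β) ^ n * ∏ k ∈ Finset.range n, logRatio k)
            * Real.exp (β * y / Real.log y) := by
          rw [mul_div_right_comm 2 (Real.exp 1), mul_pow]; ring
      _ ≤ Real.exp B * (D ^ n * ∏ k ∈ Finset.range n, logRatio k)
            * Real.exp (β * y / Real.log y) := by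
          gcongr
          · exact Real.one_le_exp hB
          · exact le_max_right _ _
      _ = _ := by rw [Finset.prod_mul_distrib]; simp
  · have hn : (n : ℝ) ≤ Real.sqrt y := by
      have h1 : Real.log (((n : ℝ) + 3) ^ 2) ≤ Real.log y := by
        rw [Real.log_pow]; exact_mod_cast h
      have h2 : ((n : ℝ) + 3) ^ 2 ≤ y := (Real.log_le_log_iff (by positivity) hy0).1 h1
      have := Real.le_sqrt_of_sq_le h2
      linarith
    have hprod : 1 ≤ ∏ k ∈ Finset.range n, D * logRatio k :=
      Finset.one_le_prod fun k _ => one_le_mul_of_one_le_of_one_le hD1 (one_le_logRatio k)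
    calc y ^ n = Real.exp (n * Real.log y) := by
          rw [Real.exp_nat_mul, Real.exp_log hy0]
      _ ≤ Real.exp (B + β * y / Real.log y) :=
          Real.exp_le_exp.2 ((mul_le_mul_of_nonneg_right hn hl.le).trans (hBy y hy))
      _ = Real.exp B * 1 * Real.exp (β * y / Real.log y) := by rw [Real.exp_add, mul_one]
      _ ≤ _ := by gcongr

lemma not_integrableOn_of_hardy {α C A c : ℝ} {f : ℝ → ℝ} (hC : 1 ≤ C) (hc : 0 < c)
    (hfb : ∀ x : ℝ, A ≤ x → C⁻¹ * Real.exp (-(α * Real.sqrt x / Real.log x)) ≤ f x) :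
    ¬ IntegrableOn (fun x : ℝ => Real.exp (c * Real.sqrt x) * f x) (Ioi 0) := by
  intro h
  obtain ⟨B, hB⟩ := eventually_atTop.1 (Real.tendsto_log_atTop.eventually_ge_atTop (max 1 (α / c)))
  have hC0 : 0 < C⁻¹ := by positivity
  have hle : ∀ x ∈ Ioi (max 0 (max A B)), C⁻¹ ≤ Real.exp (c * Real.sqrt x) * f x := by
    intro x hx
    have hx' : max 0 (max A B) < x := hx
    simp only [max_lt_iff] at hx'
    have hl := hB x hx'.2.2.le
    have hl1 : 1 ≤ Real.log x := (le_max_left _ _).trans hl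
    have hl2 : α ≤ c * Real.log x := by
      have := (le_max_right _ _).trans hl
      rwa [div_le_iff₀' hc] at this
    have hdiv : α * Real.sqrt x / Real.log x ≤ c * Real.sqrt x := by
      rw [div_le_iff₀ (by linarith)]
      nlinarith [Real.sqrt_nonneg x]
    calc C⁻¹ ≤ C⁻¹ * Real.exp (c * Real.sqrt x + -(α * Real.sqrt x / Real.log x)) :=
          le_mul_of_one_le_right hC0.le (Real.one_le_exp (by linarith))
      _ = Real.exp (c * Real.sqrt x) * (C⁻¹ * Real.exp (-(α * Real.sqrt x / Real.log x))) := by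
          rw [Real.exp_add]; ring
      _ ≤ _ := by
          gcongr
          exact hfb x hx'.2.1.le
  have h1 : IntegrableOn (fun x : ℝ => Real.exp (c * Real.sqrt x) * f x)
      (Ioi (max 0 (max A B))) := h.mono_set (Ioi_subset_Ioi (le_max_left _ _))
  have h2 : IntegrableOn (fun _ : ℝ => C⁻¹) (Ioi (max 0 (max A B))) := by
    refine Integrable.mono' h1 aestronglyMeasurable_const ?_
    refine (ae_restrict_iff' measurableSet_Ioi).2 (ae_of_all _ fun x hx => ?_)
    rw [Real.norm_of_nonneg hC0.le]
    exact hle x hx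
  rw [integrableOn_const_iff] at h2
  simp [hC0.ne'] at h2

lemma integrableOn_exp_div_log {α C A : ℝ} {ν : Measure ℝ} {f : ℝ → ℝ} (hα : 0 < α)
    (hf : ν = volume.withDensity (fun x => ENNReal.ofReal (f x)))
    (hC : 1 ≤ C) (hA : 1 < A)
    (hfb : ∀ x : ℝ, A ≤ x → f x ≤ C * Real.exp (-(α * Real.sqrt x / Real.log x))) :
    IntegrableOn (fun x => Real.exp (α / 4 * Real.sqrt x / Real.log (Real.sqrt x))) (Ici A) ν := by
  obtain ⟨K, D, hK, hD, -, hpow⟩ := exists_pow_le_mul_exp_div_log (β := α / 4) (D₀ := 0)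
    (by positivity)
  set u : ℝ → ℝ := fun x => C * Real.exp (-(α * Real.sqrt x / Real.log x)) with hu
  have hum : Measurable fun x => ENNReal.ofReal (u x) := by fun_prop
  have hle : ν.restrict (Ici A) ≤
      (volume.restrict (Ici A)).withDensity fun x => ENNReal.ofReal (u x) := by
    rw [hf, restrict_withDensity measurableSet_Ici]
    exact withDensity_mono ((ae_restrict_iff' measurableSet_Ici).2 (ae_of_all _ fun x hx =>
      ENNReal.ofReal_le_ofReal (hfb x hx)))
  refine Integrable.mono_measure ?_ hle
  rw [integrable_withDensity_iff hum (by simp)]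
  set P := K * ∏ k ∈ Finset.range 4, D * logRatio k with hP
  have hint : IntegrableOn (fun x : ℝ => C * P * x ^ (-2 : ℝ)) (Ici A) := by
    rw [integrableOn_Ici_iff_integrableOn_Ioi]
    exact (integrableOn_Ioi_rpow_of_lt (by norm_num) (by linarith)).const_mul _
  refine Integrable.mono' hint (by fun_prop) ?_
  refine (ae_restrict_iff' measurableSet_Ici).2 (ae_of_all _ fun x hx => ?_)
  have hx1 : 1 < x := hA.trans_le hx
  have hy : 1 < Real.sqrt x := Real.lt_sqrt_of_sq_lt (by simpa using hx1)
  have hb := hpow 4 (Real.sqrt x) hy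
  set b := α / 4 * Real.sqrt x / Real.log (Real.sqrt x) with hb_def
  have hub : u x = C * Real.exp (-(2 * b)) := by
    rw [hu, hb_def, Real.log_sqrt (by linarith)]
    have : Real.log x ≠ 0 := (Real.log_pos hx1).ne'
    simp only
    congr 3
    field_simp
    norm_num
  have h4 : Real.sqrt x ^ 4 = x ^ 2 := by
    rw [show 4 = 2 * 2 by norm_num, pow_mul, Real.sq_sqrt (by linarith)]
  rw [h4] at hb
  rw [ENNReal.toReal_ofReal (by positivity), hub, Real.norm_of_nonneg (by positivity),
    Real.rpow_neg (by linarith), Real.rpow_two]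
  calc Real.exp b * (C * Real.exp (-(2 * b))) = C * Real.exp (-b) := by
        rw [mul_left_comm, ← Real.exp_add]; ring_nf
    _ ≤ C * (P * (x ^ 2)⁻¹) := by
        gcongr
        rw [← div_eq_mul_inv, le_div_iff₀ (by positivity), Real.exp_neg,
          inv_mul_le_iff₀ (Real.exp_pos _), mul_comm]
        exact hb
    _ = _ := by ring

/-- **Corollary 1.5(2)**: a density `ν(x) ≍ exp(-α√x/log x)` fails Hardy's condition for
every `c > 0`, yet all moments are finite and `ν` is moment determinate for all `α > 0`. -/
theorem hardy_fails_yet_determinate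
    (α : ℝ) (hα : 0 < α)
    (ν : Measure ℝ) [IsProbabilityMeasure ν] (hsupp : SupportIsIci ν)
    (f : ℝ → ℝ) (hf : ν = volume.withDensity (fun x => ENNReal.ofReal (f x)))
    (C A : ℝ) (hC : 1 ≤ C) (hA : Real.exp 1 < A)
    (hfb : ∀ x : ℝ, A ≤ x →
      C⁻¹ * Real.exp (-(α * Real.sqrt x / Real.log x)) ≤ f x ∧
      f x ≤ C * Real.exp (-(α * Real.sqrt x / Real.log x))) :
    (∀ c : ℝ, 0 < c →
      ¬ IntegrableOn (fun x : ℝ => Real.exp (c * Real.sqrt x) * f x) (Ioi 0)) ∧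
    (∀ n : ℕ, Integrable (fun x => x ^ n) ν) ∧
    MomentDeterminate ν := by
  refine ⟨fun c hc => not_integrableOn_of_hardy hC hc fun x hx => (hfb x hx).1, ?_⟩
  have hA1 : 1 < A := (Real.one_lt_exp_iff.2 one_pos).trans hA
  obtain ⟨K, D, hK, hD, hAD, hpow⟩ := exists_pow_le_mul_exp_div_log (β := α / 4) (D₀ := A)
    (by positivity)
  set P : ℕ → ℝ := fun n => K * ∏ k ∈ Finset.range n, D * logRatio k with hP
  have hr1 : ∀ n, 1 ≤ D * logRatio n :=
    fun n => one_le_mul_of_one_le_of_one_le hD (one_le_logRatio n)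
  have hDP : ∀ n, D ^ n ≤ P n := fun n => by
    have h1 : D ^ n ≤ ∏ k ∈ Finset.range n, D * logRatio k := by
      calc D ^ n = ∏ k ∈ Finset.range n, D := by simp
        _ ≤ _ := Finset.prod_le_prod (fun _ _ => by linarith) fun k _ =>
          le_mul_of_one_le_right (by linarith) (one_le_logRatio k)
    exact h1.trans (le_mul_of_one_le_left ((by positivity : 0 ≤ D ^ n).trans h1) hK)
  have hP0 : ∀ n, 0 ≤ P n := fun n => (by positivity : 0 ≤ D ^ n).trans (hDP n)
  set G : ℝ → ℝ := fun x => 1 + (Ici A).indicator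
    (fun x => Real.exp (α / 4 * Real.sqrt x / Real.log (Real.sqrt x))) x with hG
  have hGi : Integrable G ν := (integrable_const 1).add
    ((integrableOn_exp_div_log hα hf hC hA1 fun x hx => (hfb x hx).2).integrable_indicator
      measurableSet_Ici)
  have hG0 : 0 ≤ ∫ x, G x ∂ν := integral_nonneg fun x =>
    add_nonneg zero_le_one (indicator_nonneg (fun _ _ => Real.exp_nonneg _) x)
  have hnn : ∀ᵐ x ∂ν, 0 ≤ x := by simpa [ae_iff, Iio] using hsupp.1
  have hle : ∀ n : ℕ, ∀ᵐ x ∂ν, x ^ n ≤ P (2 * n) * G x := fun n => by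
    filter_upwards [hnn] with x hx
    rcases lt_or_ge x A with h | h
    · have hGx : G x = 1 := by simp [hG, h]
      calc x ^ n ≤ D ^ n := pow_le_pow_left₀ hx (h.le.trans hAD) n
        _ ≤ D ^ (2 * n) := pow_le_pow_right₀ hD (by omega)
        _ ≤ P (2 * n) * G x := by rw [hGx, mul_one]; exact hDP _
    · have hGx : Real.exp (α / 4 * Real.sqrt x / Real.log (Real.sqrt x)) ≤ G x := by
        simp [hG, h]
      have hy : 1 < Real.sqrt x := Real.lt_sqrt_of_sq_lt (by simpa using hA1.trans_le h)
      calc x ^ n = Real.sqrt x ^ (2 * n) := by rw [pow_mul, Real.sq_sqrt hx]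
        _ ≤ P (2 * n) * Real.exp (α / 4 * Real.sqrt x / Real.log (Real.sqrt x)) := hpow _ _ hy
        _ ≤ _ := mul_le_mul_of_nonneg_left hGx (hP0 _)
  have hint : ∀ n : ℕ, Integrable (fun x => x ^ n) ν := fun n => by
    refine (hGi.const_mul (P (2 * n))).mono' (by fun_prop) ?_
    filter_upwards [hnn, hle n] with x hx hx'
    rwa [Real.norm_of_nonneg (by positivity)]
  refine ⟨hint, fun μ hμ hμi hmom => ?_⟩
  refine measure_eq_of_stieltjes_moments_eq (M := fun n => (∫ x, G x ∂ν) * P n)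
    (r := fun n => D * logRatio n) (c := 4) hμ hsupp.1 hμi hint ?_ ?_
    (fun n => one_pos.trans_le (hr1 n)) (fun n => mul_nonneg hG0 (hP0 n)) (by norm_num) ?_ ?_ ?_
    hmom
  · intro n
    simp only [hP, Finset.prod_range_succ]
    ring
  · exact monotone_logRatio.const_mul (by linarith)
  · intro n
    have := logRatio_succ_le n
    calc D * logRatio (n + 1) ≤ D * (4 * logRatio n) := by gcongr
      _ = _ := by ring
  · intro h
    refine not_summable_inv_logRatio ((h.mul_left D).congr fun n => ?_)
    rw [mul_inv, mul_inv_cancel_left₀ (by linarith)]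
  · intro n
    refine (integral_mono_ae (hint n) (hGi.const_mul _) (hle n)).trans_eq ?_
    rw [integral_const_mul, mul_comm]
end
end

section
/- Let b ∈ ℝ, σ > 0, and let Π be a σ-finite positive measure on ℝ with Π({0}) = 0, ∫ min(1,r²) dΠ(r) < ∞ and ∫₁^∞ e^{ur} dΠ(r) < ∞ for every u ≥ 0, and set Ψ(u) = bu + σ²u²/2 + ∫ (e^{ur} − 1 − ur·1_{{|r|≤1}}) dΠ(r) for u ≥ 0. Fix t > 0, and let ν be a probability measure on [0,∞) with support equal to [0,∞) whose moments satisfy ∫₀^∞ xⁿ dν(x) = e^{tΨ(n)} for every integer n ≥ 0. Then ν is moment indeterminate. -/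
open MeasureTheory Set Filter

noncomputable section

open ProbabilityTheory
open scoped ENNReal NNReal Topology

/-- Iterated additive convolution powers of a measure on `ℝ`. -/
def convPow (Λ : Measure ℝ) : ℕ → Measure ℝ
  | 0 => Measure.dirac 0
  | j + 1 => Λ.conv (convPow Λ j)

instance isFiniteMeasure_convPow (Λ : Measure ℝ) [IsFiniteMeasure Λ] (j : ℕ) :
    IsFiniteMeasure (convPow Λ j) := by
  induction j with
  | zero => unfold convPow; infer_instance
  | succ j ih => unfold convPow; infer_instance

lemma lintegral_exp_conv (μ ν : Measure ℝ) [SFinite ν] (v : ℝ) :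
    ∫⁻ x, ENNReal.ofReal (Real.exp (v * x)) ∂(μ.conv ν) =
      (∫⁻ x, ENNReal.ofReal (Real.exp (v * x)) ∂μ) *
        ∫⁻ x, ENNReal.ofReal (Real.exp (v * x)) ∂ν := by
  rw [Measure.lintegral_conv (by fun_prop), ← lintegral_mul_const _ (by fun_prop)]
  refine lintegral_congr fun x => ?_
  rw [← lintegral_const_mul _ (by fun_prop)]
  refine lintegral_congr fun y => ?_
  rw [← ENNReal.ofReal_mul (Real.exp_nonneg _), ← Real.exp_add, mul_add]

lemma lintegral_exp_convPow (Λ : Measure ℝ) [IsFiniteMeasure Λ] (v : ℝ) (j : ℕ) :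
    ∫⁻ x, ENNReal.ofReal (Real.exp (v * x)) ∂(convPow Λ j) =
      (∫⁻ x, ENNReal.ofReal (Real.exp (v * x)) ∂Λ) ^ j := by
  induction j with
  | zero => simp [convPow]
  | succ j ih => rw [convPow, lintegral_exp_conv, ih, pow_succ']

lemma ENNReal.tsum_ofReal_pow_div_factorial {x : ℝ} (hx : 0 ≤ x) :
    ∑' j : ℕ, ENNReal.ofReal (x ^ j / j.factorial) = ENNReal.ofReal (Real.exp x) := by
  have h := NormedSpace.expSeries_div_hasSum_exp (𝔸 := ℝ) x
  rw [← Real.exp_eq_exp_ℝ] at h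
  rw [← h.tsum_eq, ENNReal.ofReal_tsum_of_nonneg (fun j => by positivity) h.summable]

/-- The compound Poisson law with finite jump measure `Λ`. -/
def compoundPoisson (Λ : Measure ℝ) : Measure ℝ :=
  Measure.sum fun j : ℕ =>
    ENNReal.ofReal (Real.exp (-Λ.real univ) / j.factorial) • convPow Λ j

lemma lintegral_exp_compoundPoisson (Λ : Measure ℝ) [IsFiniteMeasure Λ] {v : ℝ}
    (hv : Integrable (fun x => Real.exp (v * x)) Λ) :
    ∫⁻ x, ENNReal.ofReal (Real.exp (v * x)) ∂(compoundPoisson Λ) =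
      ENNReal.ofReal (Real.exp (∫ x, (Real.exp (v * x) - 1) ∂Λ)) := by
  have h0 : 0 ≤ ∫ x, Real.exp (v * x) ∂Λ := integral_nonneg fun x => Real.exp_nonneg _
  have hI : ∫ x, (Real.exp (v * x) - 1) ∂Λ = ∫ x, Real.exp (v * x) ∂Λ - Λ.real univ := by
    rw [integral_sub hv (integrable_const _)]; simp
  rw [compoundPoisson, lintegral_sum_measure, hI, sub_eq_add_neg, Real.exp_add, mul_comm,
    ENNReal.ofReal_mul (Real.exp_nonneg _), ← ENNReal.tsum_ofReal_pow_div_factorial h0,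
    ← ENNReal.tsum_mul_left]
  refine tsum_congr fun j => ?_
  rw [lintegral_smul_measure, lintegral_exp_convPow,
    ← ofReal_integral_eq_lintegral_ofReal hv (ae_of_all _ fun x => Real.exp_nonneg _),
    ← ENNReal.ofReal_pow h0, smul_eq_mul, ← ENNReal.ofReal_mul (by positivity),
    ← ENNReal.ofReal_mul (by positivity)]
  congr 1; ring

instance isProbabilityMeasure_compoundPoisson (Λ : Measure ℝ) [IsFiniteMeasure Λ] :
    IsProbabilityMeasure (compoundPoisson Λ) := by
  constructor
  have h := lintegral_exp_compoundPoisson Λ (v := 0) (by simp)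
  simpa using h

lemma exists_measure_of_tendsto_moments (ρ : ℕ → Measure ℝ≥0)
    [∀ k, IsProbabilityMeasure (ρ k)] (m : ℕ → ℝ≥0∞) (C : ℕ → ℝ≥0)
    (hC : ∀ n k, ∫⁻ x, (x : ℝ≥0∞) ^ n ∂(ρ k) ≤ C n)
    (hm : ∀ n, Tendsto (fun k => ∫⁻ x, (x : ℝ≥0∞) ^ n ∂(ρ k)) atTop (𝓝 (m n))) :
    ∃ μ : Measure ℝ≥0, IsProbabilityMeasure μ ∧ ∀ n, ∫⁻ x, (x : ℝ≥0∞) ^ n ∂μ = m n := by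
  let P : ℕ → ProbabilityMeasure ℝ≥0 := fun k => ⟨ρ k, inferInstance⟩
  have htight : IsTightMeasureSet {((μ : ProbabilityMeasure ℝ≥0) : Measure ℝ≥0) | μ ∈ range P} := by
    rw [isTightMeasureSet_iff_exists_isCompact_measure_compl_le]
    intro ε hε
    obtain ⟨N, hN⟩ := ENNReal.exists_nat_mul_gt hε.ne' (ENNReal.coe_ne_top (r := C 1))
    refine ⟨Icc 0 (N : ℝ≥0), isCompact_Icc, ?_⟩
    rintro _ ⟨_, ⟨k, rfl⟩, rfl⟩
    have h1 : (N : ℝ≥0∞) * ρ k (Icc 0 (N : ℝ≥0))ᶜ ≤ C 1 := by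
      refine le_trans ?_ (hC 1 k)
      refine le_trans ?_ (mul_meas_ge_le_lintegral (by fun_prop) (N : ℝ≥0∞))
      gcongr
      intro x hx
      simp only [mem_compl_iff, mem_Icc, zero_le, true_and, not_le] at hx
      simp only [pow_one, mem_ofPred_eq]
      exact_mod_cast hx.le
    have hN0 : (N : ℝ≥0∞) ≠ 0 := by
      rintro h
      simp [h] at hN
    by_contra! hlt
    exact absurd (hN.trans_le ((mul_le_mul_right hlt.le (N : ℝ≥0∞)).trans h1)) (lt_irrefl _)
  obtain ⟨μ, -, φ, hφ, hlim⟩ := (isCompact_closure_of_isTightMeasureSet htight).tendsto_subseq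
    (x := P) fun k => subset_closure (mem_range_self k)
  have hweak := ProbabilityMeasure.tendsto_iff_forall_lintegral_tendsto.1 hlim
  have htrunc : ∀ (n : ℕ) (R : ℝ≥0), Tendsto
      (fun k => ∫⁻ x, ((min (x ^ n) R : ℝ≥0) : ℝ≥0∞) ∂(ρ (φ k))) atTop
      (𝓝 (∫⁻ x, ((min (x ^ n) R : ℝ≥0) : ℝ≥0∞) ∂(μ : Measure ℝ≥0))) := by
    intro n R
    exact hweak (BoundedContinuousFunction.mkOfBound ⟨fun x => min (x ^ n) R, by fun_prop⟩ R (by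
      intro x y
      rw [NNReal.dist_eq, abs_le]
      have h1 : min (x ^ n) R ≤ R := min_le_right _ _
      have h2 : min (y ^ n) R ≤ R := min_le_right _ _
      have h3 : (0:ℝ) ≤ (min (x ^ n) R : ℝ≥0) := NNReal.coe_nonneg _
      have h4 : (0:ℝ) ≤ (min (y ^ n) R : ℝ≥0) := NNReal.coe_nonneg _
      rw [← NNReal.coe_le_coe] at h1 h2
      constructor <;> simp only [ContinuousMap.coe_mk] <;> linarith))
  have hsub : ∀ n, Tendsto (fun k => ∫⁻ x, (x : ℝ≥0∞) ^ n ∂(ρ (φ k))) atTop (𝓝 (m n)) :=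
    fun n => (hm n).comp hφ.tendsto_atTop
  refine ⟨μ, inferInstance, fun n => le_antisymm ?_ ?_⟩
  · have hmono : ∫⁻ x, (x : ℝ≥0∞) ^ n ∂(μ : Measure ℝ≥0) =
        ⨆ R : ℕ, ∫⁻ x, ((min (x ^ n) R : ℝ≥0) : ℝ≥0∞) ∂(μ : Measure ℝ≥0) := by
      rw [← lintegral_iSup (fun R => by fun_prop)]
      · refine lintegral_congr fun x => le_antisymm ?_ ?_
        · obtain ⟨N, hN⟩ := exists_nat_ge (x ^ n)
          refine le_iSup_of_le N ?_
          rw [min_eq_left hN]; simp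
        · refine iSup_le fun R => ?_
          rw [← ENNReal.coe_pow, ENNReal.coe_le_coe]
          exact min_le_left _ _
      · intro R S hRS x
        have : (R : ℝ≥0) ≤ S := by exact_mod_cast hRS
        exact ENNReal.coe_le_coe.2 (min_le_min_left _ this)
    rw [hmono]
    refine iSup_le fun R => le_of_tendsto_of_tendsto' (htrunc n R) (hsub n) fun k => ?_
    refine lintegral_mono fun x => ?_
    rw [← ENNReal.coe_pow, ENNReal.coe_le_coe]
    exact min_le_left _ _
  · have hbound : ∀ R : ℕ, R ≠ 0 → m n ≤ ∫⁻ x, (x : ℝ≥0∞) ^ n ∂(μ : Measure ℝ≥0) +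
        C (n + n) / (R : ℝ≥0∞) := by
      intro R hR
      have hR0 : (0 : ℝ≥0) < R := by exact_mod_cast Nat.pos_of_ne_zero hR
      have hle : ∀ k, ∫⁻ x, (x : ℝ≥0∞) ^ n ∂(ρ (φ k)) ≤
          ∫⁻ x, ((min (x ^ n) R : ℝ≥0) : ℝ≥0∞) ∂(ρ (φ k)) + C (n + n) / (R : ℝ≥0∞) := by
        intro k
        calc ∫⁻ x, (x : ℝ≥0∞) ^ n ∂(ρ (φ k))
            ≤ ∫⁻ x, (((min (x ^ n) R : ℝ≥0) : ℝ≥0∞) + (x : ℝ≥0∞) ^ (n + n) / (R : ℝ≥0∞))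
                ∂(ρ (φ k)) := by
              refine lintegral_mono fun x => ?_
              have key : x ^ n ≤ min (x ^ n) (R : ℝ≥0) + x ^ (n + n) / (R : ℝ≥0) := by
                rcases le_total (x ^ n) (R : ℝ≥0) with h | h
                · rw [min_eq_left h]; exact le_self_add
                · refine le_trans ?_ le_add_self
                  rw [le_div_iff₀ hR0, pow_add]
                  gcongr
              have := ENNReal.coe_le_coe.2 key
              rwa [ENNReal.coe_add, ENNReal.coe_div hR0.ne', ENNReal.coe_pow, ENNReal.coe_pow,
                ENNReal.coe_natCast] at this
          _ ≤ _ := by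
              rw [lintegral_add_left (by fun_prop)]
              simp_rw [div_eq_mul_inv]
              rw [lintegral_mul_const _ (by fun_prop)]
              gcongr
              exact hC _ _
      have h2 := le_of_tendsto_of_tendsto' (hsub n) ((htrunc n R).add_const _) hle
      refine h2.trans ?_
      gcongr with x
      rw [← ENNReal.coe_pow, ENNReal.coe_le_coe]
      exact min_le_left _ _
    have hlim0 : Tendsto (fun R : ℕ => ∫⁻ x, (x : ℝ≥0∞) ^ n ∂(μ : Measure ℝ≥0) +
        C (n + n) / (R : ℝ≥0∞)) atTop (𝓝 (∫⁻ x, (x : ℝ≥0∞) ^ n ∂(μ : Measure ℝ≥0) + 0)) := by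
      refine Tendsto.const_add _ ?_
      exact ENNReal.Tendsto.const_div ENNReal.tendsto_nat_nhds_top (Or.inr ENNReal.coe_ne_top)|>.trans (by simp)
    rw [add_zero] at hlim0
    exact ge_of_tendsto hlim0 (eventually_atTop.2 ⟨1, fun R hR => hbound R (by omega)⟩)

lemma ext_of_lintegral_exp_eq {D₁ D₂ : Measure ℝ} [IsProbabilityMeasure D₁]
    [IsProbabilityMeasure D₂] (h₁ : integrableExpSet id D₁ = univ)
    (h₂ : integrableExpSet id D₂ = univ)
    (h : ∀ v ∈ Ioo (0 : ℝ) 1, ∫⁻ x, ENNReal.ofReal (Real.exp (v * x)) ∂D₁ =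
      ∫⁻ x, ENNReal.ofReal (Real.exp (v * x)) ∂D₂) : D₁ = D₂ := by
  have hmgf : ∀ v ∈ Ioo (0 : ℝ) 1, mgf id D₁ v = mgf id D₂ v := by
    intro v hv
    have e : ∀ D : Measure ℝ, mgf id D v =
        (∫⁻ x, ENNReal.ofReal (Real.exp (v * x)) ∂D).toReal := fun D => by
      rw [mgf, integral_eq_lintegral_of_nonneg_ae (ae_of_all _ fun x => Real.exp_nonneg _)
        (by fun_prop)]
      rfl
    rw [e, e, h v hv]
  have hA₁ : AnalyticOnNhd ℂ (complexMGF id D₁) univ := by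
    simpa [h₁] using analyticOnNhd_complexMGF (X := (id : ℝ → ℝ)) (μ := D₁)
  have hA₂ : AnalyticOnNhd ℂ (complexMGF id D₂) univ := by
    simpa [h₂] using analyticOnNhd_complexMGF (X := (id : ℝ → ℝ)) (μ := D₂)
  refine Measure.ext_of_complexMGF_id_eq (hA₁.eq_of_frequently_eq (z₀ := ((1 / 2 : ℝ) : ℂ)) hA₂ ?_)
  have hev : ∀ᶠ x : ℝ in 𝓝[≠] (1 / 2 : ℝ), complexMGF id D₁ x = complexMGF id D₂ x := by
    filter_upwards [nhdsWithin_le_nhds (Ioo_mem_nhds (a := (0 : ℝ)) (b := 1)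
      (by norm_num) (by norm_num))] with x hx
    rw [complexMGF_ofReal, complexMGF_ofReal, hmgf x hx]
  have ht : Tendsto (fun x : ℝ => (x : ℂ)) (𝓝[≠] (1 / 2 : ℝ)) (𝓝[≠] ((1 / 2 : ℝ) : ℂ)) := by
    refine tendsto_nhdsWithin_iff.2 ⟨?_, ?_⟩
    · exact (Complex.continuous_ofReal.tendsto _).mono_left nhdsWithin_le_nhds
    · filter_upwards [self_mem_nhdsWithin] with x hx
      exact fun h' => hx (Complex.ofReal_injective h')
  exact ht.frequently hev.frequently

lemma lintegral_exp_gaussianReal (w : ℝ≥0) (v : ℝ) :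
    ∫⁻ x, ENNReal.ofReal (Real.exp (v * x)) ∂(gaussianReal 0 w) =
      ENNReal.ofReal (Real.exp (w * v ^ 2 / 2)) := by
  have hi := integrable_exp_mul_gaussianReal (μ := 0) (v := w) v
  rw [← ofReal_integral_eq_lintegral_ofReal hi (ae_of_all _ fun x => Real.exp_nonneg _)]
  have h := congrFun (mgf_id_gaussianReal (μ := 0) (v := w)) v
  simp only [mgf, id, zero_mul, zero_add] at h
  rw [h]

/-- The total mass of the weights `exp (-w k² / 2)`, `k ∈ ℤ`. -/
def latticeGaussianMass (w : ℝ) : ℝ≥0∞ :=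
  ∑' k : ℤ, ENNReal.ofReal (Real.exp (-(w * k ^ 2 / 2)))

lemma latticeGaussianMass_ne_zero (w : ℝ) : latticeGaussianMass w ≠ 0 := by
  intro h
  have := ENNReal.tsum_eq_zero.1 h 0
  simp at this

lemma latticeGaussianMass_ne_top {w : ℝ} (hw : 0 < w) : latticeGaussianMass w ≠ ⊤ := by
  have h := summable_pow_mul_jacobiTheta₂_term_bound 0 (T := w / (2 * Real.pi)) (by positivity) 0
  have h' : Summable fun k : ℤ => Real.exp (-(w * k ^ 2 / 2)) := by
    refine h.congr fun k => ?_
    have := Real.pi_ne_zero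
    simp
    field_simp
  exact h'.tsum_ofReal_ne_top

/-- The law of `w * k` with `k ∈ ℤ` weighted by `exp (-w k² / 2)`: its exponential moments at
integers are those of the Gaussian law of variance `w`. -/
def latticeGaussian (w : ℝ) : Measure ℝ :=
  (latticeGaussianMass w)⁻¹ • Measure.sum fun k : ℤ =>
    ENNReal.ofReal (Real.exp (-(w * k ^ 2 / 2))) • Measure.dirac (w * k)

lemma lintegral_exp_latticeGaussian {w : ℝ} (hw : 0 < w) (n : ℤ) :
    ∫⁻ x, ENNReal.ofReal (Real.exp (n * x)) ∂(latticeGaussian w) =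
      ENNReal.ofReal (Real.exp (w * n ^ 2 / 2)) := by
  have hsum : ∑' k : ℤ, ENNReal.ofReal (Real.exp (-(w * k ^ 2 / 2))) *
      ENNReal.ofReal (Real.exp (n * (w * k))) =
      ENNReal.ofReal (Real.exp (w * n ^ 2 / 2)) * latticeGaussianMass w := by
    rw [latticeGaussianMass, ← ENNReal.tsum_mul_left, ← (Equiv.subRight n).tsum_eq
      (fun k : ℤ => ENNReal.ofReal (Real.exp (w * n ^ 2 / 2)) *
        ENNReal.ofReal (Real.exp (-(w * k ^ 2 / 2))))]
    refine tsum_congr fun k => ?_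
    rw [← ENNReal.ofReal_mul (Real.exp_nonneg _), ← ENNReal.ofReal_mul (Real.exp_nonneg _),
      ← Real.exp_add, ← Real.exp_add]
    congr 2
    rw [Equiv.subRight_apply, Int.cast_sub]
    ring
  rw [latticeGaussian, lintegral_smul_measure, lintegral_sum_measure]
  simp_rw [lintegral_smul_measure, lintegral_dirac, smul_eq_mul]
  rw [hsum, mul_comm, mul_assoc, ENNReal.mul_inv_cancel (latticeGaussianMass_ne_zero w)
    (latticeGaussianMass_ne_top hw), mul_one]

lemma isProbabilityMeasure_latticeGaussian {w : ℝ} (hw : 0 < w) :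
    IsProbabilityMeasure (latticeGaussian w) :=
  ⟨by simpa using lintegral_exp_latticeGaussian hw 0⟩

lemma integrableExpSet_latticeGaussian {w : ℝ} (hw : 0 < w) :
    integrableExpSet id (latticeGaussian w) = univ := by
  have hint : ∀ n : ℤ, (n : ℝ) ∈ integrableExpSet id (latticeGaussian w) := by
    intro n
    refine ⟨by fun_prop, ?_⟩
    rw [hasFiniteIntegral_iff_ofReal (ae_of_all _ fun x => Real.exp_nonneg _)]
    simp only [id]
    rw [lintegral_exp_latticeGaussian hw]
    exact ENNReal.ofReal_lt_top
  refine eq_univ_of_forall fun v => ?_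
  exact convex_integrableExpSet.ordConnected.out (hint ⌊v⌋) (hint ⌈v⌉)
    ⟨Int.floor_le v, Int.le_ceil v⟩

lemma latticeGaussian_ne_gaussianReal {w : ℝ≥0} (hw : 0 < w) :
    latticeGaussian w ≠ gaussianReal 0 w := by
  intro h
  have := nullSingletonClass_gaussianReal (μ := 0) hw.ne'
  have h0 : latticeGaussian w {0} = 0 := by rw [h]; exact measure_singleton 0
  rw [latticeGaussian, Measure.smul_apply, Measure.sum_apply _ (measurableSet_singleton 0),
    smul_eq_mul, mul_eq_zero] at h0
  rcases h0 with h0 | h0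
  · exact latticeGaussianMass_ne_top (w := w) (by exact_mod_cast hw) (ENNReal.inv_eq_zero.1 h0)
  · have := ENNReal.tsum_eq_zero.1 h0 0
    simp at this

/-- The integrand of the jump part of the Lévy–Khintchine exponent. -/
def levyIntegrand (u r : ℝ) : ℝ :=
  Real.exp (u * r) - 1 - (if |r| ≤ 1 then u * r else 0)

lemma measurable_levyIntegrand (u : ℝ) : Measurable (levyIntegrand u) := by
  unfold levyIntegrand
  refine Measurable.sub (by fun_prop) (Measurable.ite ?_ (by fun_prop) measurable_const)
  exact measurableSet_le (by fun_prop) measurable_const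

lemma abs_levyIntegrand_le {u : ℝ} (hu : 0 ≤ u) (r : ℝ) :
    |levyIntegrand u r| ≤ (u ^ 2 * Real.exp u + 1) * min 1 (r ^ 2) +
      (Ioi (1 : ℝ)).indicator (fun r => Real.exp (u * r)) r := by
  have hind : 0 ≤ (Ioi (1 : ℝ)).indicator (fun r => Real.exp (u * r)) r :=
    indicator_nonneg (fun _ _ => Real.exp_nonneg _) _
  unfold levyIntegrand
  split_ifs with h
  · have hr2 : r ^ 2 ≤ 1 := by rw [← sq_abs]; exact pow_le_one₀ (abs_nonneg _) h
    rw [min_eq_right hr2]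
    have h1 := Complex.norm_exp_sub_sum_le_norm_mul_exp ((u * r : ℝ) : ℂ) 2
    have h2 : |u * r| ≤ u := by
      rw [abs_mul, abs_of_nonneg hu]; exact mul_le_of_le_one_right hu h
    have h3 : |Real.exp (u * r) - 1 - u * r| ≤ |u * r| ^ 2 * Real.exp |u * r| := by
      rw [Complex.norm_real, Real.norm_eq_abs] at h1
      rw [← Real.norm_eq_abs (Real.exp _ - 1 - _), ← Complex.norm_real]
      refine le_of_eq_of_le ?_ h1
      simp [Finset.sum_range_succ, sub_sub]
    have h4 : |u * r| ^ 2 * Real.exp |u * r| ≤ (u ^ 2 * r ^ 2) * Real.exp u := by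
      rw [sq_abs, mul_pow]; gcongr
    nlinarith [sq_nonneg r]
  · have hr1 : 1 ≤ r ^ 2 := by
      rw [← sq_abs]; exact one_le_pow₀ (not_le.1 h).le
    rw [min_eq_left hr1, mul_one, sub_zero]
    have hc : 0 ≤ u ^ 2 * Real.exp u := by positivity
    rcases lt_abs.1 (not_le.1 h) with h | h
    · rw [indicator_of_mem (mem_Ioi.2 h)]
      have : 1 ≤ Real.exp (u * r) := Real.one_le_exp (by nlinarith)
      rw [abs_of_nonneg (by linarith)]; linarith
    · have : Real.exp (u * r) ≤ 1 := Real.exp_le_one_iff.2 (by nlinarith)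
      have := Real.exp_pos (u * r)
      rw [abs_of_nonpos (by linarith)]; linarith

lemma integrable_levyIntegrand {Pim : Measure ℝ} {u : ℝ} (hu : 0 ≤ u)
    (hmin : Integrable (fun r : ℝ => min 1 (r ^ 2)) Pim)
    (hexp : IntegrableOn (fun r => Real.exp (u * r)) (Ioi 1) Pim) :
    Integrable (levyIntegrand u) Pim :=
  ((hmin.const_mul _).add (hexp.integrable_indicator measurableSet_Ioi)).mono'
    (measurable_levyIntegrand u).aestronglyMeasurable
    (ae_of_all _ fun r => abs_levyIntegrand_le hu r)

/-- The jumps of absolute value larger than `1 / (k + 1)`. -/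
def largeJumps (k : ℕ) : Set ℝ := {r | 1 / ((k : ℝ) + 1) < |r|}

lemma measurableSet_largeJumps (k : ℕ) : MeasurableSet (largeJumps k) :=
  measurableSet_lt measurable_const (by fun_prop)

lemma measure_largeJumps_lt_top {Pim : Measure ℝ}
    (hmin : Integrable (fun r : ℝ => min 1 (r ^ 2)) Pim) (k : ℕ) :
    Pim (largeJumps k) < ⊤ := by
  have hk : (0 : ℝ) < 1 / ((k : ℝ) + 1) := by positivity
  refine (measure_mono fun r hr => ?_).trans_lt
    (hmin.measure_ge_lt_top (ε := min 1 ((1 / ((k : ℝ) + 1)) ^ 2)) (by positivity))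
  have hr' : 1 / ((k : ℝ) + 1) < |r| := hr
  simp only [mem_ofPred_eq]
  rw [← sq_abs r]
  gcongr

lemma tendsto_setIntegral_largeJumps {Pim : Measure ℝ} {u : ℝ}
    (hi : Integrable (levyIntegrand u) Pim) :
    Tendsto (fun k => ∫ r in largeJumps k, levyIntegrand u r ∂Pim) atTop
      (𝓝 (∫ r, levyIntegrand u r ∂Pim)) := by
  have h := tendsto_setIntegral_of_monotone (μ := Pim) (f := levyIntegrand u)
    measurableSet_largeJumps (fun k l hkl r (hr : 1 / ((k : ℝ) + 1) < |r|) =>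
      (lt_of_le_of_lt (by gcongr) hr : 1 / ((l : ℝ) + 1) < |r|)) hi.integrableOn
  rwa [setIntegral_eq_integral_of_forall_compl_eq_zero] at h
  intro r hr
  have hr0 : r = 0 := by
    by_contra hne
    obtain ⟨k, hk⟩ := exists_nat_one_div_lt (abs_pos.2 hne)
    exact hr (mem_iUnion.2 ⟨k, hk⟩)
  simp [levyIntegrand, hr0]

/-- The law of the exponential of the drifted compound Poisson variable with the jumps of `Pim`
larger than `1 / (k + 1)`. -/
def truncatedLevyLaw (b : ℝ) (Pim : Measure ℝ) (k : ℕ) : Measure ℝ≥0 :=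
  (compoundPoisson (Pim.restrict (largeJumps k))).map fun x =>
    (Real.exp (x + (b - ∫ r in largeJumps k, (if |r| ≤ 1 then r else 0) ∂Pim))).toNNReal

lemma isProbabilityMeasure_truncatedLevyLaw (b : ℝ) {Pim : Measure ℝ}
    (hmin : Integrable (fun r : ℝ => min 1 (r ^ 2)) Pim) (k : ℕ) :
    IsProbabilityMeasure (truncatedLevyLaw b Pim k) := by
  have : IsFiniteMeasure (Pim.restrict (largeJumps k)) :=
    ⟨by rw [Measure.restrict_apply_univ]; exact measure_largeJumps_lt_top hmin k⟩
  exact Measure.isProbabilityMeasure_map (by fun_prop)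

lemma lintegral_pow_truncatedLevyLaw (b : ℝ) {Pim : Measure ℝ}
    (hmin : Integrable (fun r : ℝ => min 1 (r ^ 2)) Pim)
    (n : ℕ) (hi : Integrable (levyIntegrand n) Pim) (k : ℕ) :
    ∫⁻ x, (x : ℝ≥0∞) ^ n ∂(truncatedLevyLaw b Pim k) =
      ENNReal.ofReal (Real.exp (b * n + ∫ r in largeJumps k, levyIntegrand n r ∂Pim)) := by
  have : IsFiniteMeasure (Pim.restrict (largeJumps k)) :=
    ⟨by rw [Measure.restrict_apply_univ]; exact measure_largeJumps_lt_top hmin k⟩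
  have hsmall : Integrable (fun r : ℝ => if |r| ≤ 1 then r else 0)
      (Pim.restrict (largeJumps k)) := by
    refine Integrable.of_bound (C := 1) (Measurable.ite (measurableSet_le (by fun_prop)
      measurable_const) (by fun_prop) measurable_const).aestronglyMeasurable
      (ae_of_all _ fun r => ?_)
    split_ifs with h
    · exact h
    · simp
  have heq : ∀ r, Real.exp (n * r) - 1 =
      levyIntegrand n r + n * (if |r| ≤ 1 then r else 0) := fun r => by
    unfold levyIntegrand; split_ifs <;> ring
  have hexp : Integrable (fun r => Real.exp (n * r)) (Pim.restrict (largeJumps k)) := by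
    refine ((hi.restrict.add (hsmall.const_mul (n : ℝ))).add (integrable_const 1)).congr
      (ae_of_all _ fun r => ?_)
    simp only [Pi.add_apply]
    rw [← heq]; ring
  rw [truncatedLevyLaw, lintegral_map (by fun_prop) (by fun_prop)]
  set d := b - ∫ r in largeJumps k, (if |r| ≤ 1 then r else 0) ∂Pim with hd
  have hpt : ∀ x : ℝ, (((Real.exp (x + d)).toNNReal : ℝ≥0) : ℝ≥0∞) ^ n =
      ENNReal.ofReal (Real.exp (n * d)) * ENNReal.ofReal (Real.exp (n * x)) := fun x => by
    change ENNReal.ofReal (Real.exp (x + d)) ^ n = _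
    rw [← ENNReal.ofReal_pow (Real.exp_nonneg _), ← ENNReal.ofReal_mul (Real.exp_nonneg _),
      ← Real.exp_nat_mul, ← Real.exp_add]
    congr 2; ring
  simp_rw [hpt]
  rw [lintegral_const_mul _ (by fun_prop), lintegral_exp_compoundPoisson _ hexp,
    ← ENNReal.ofReal_mul (Real.exp_nonneg _), ← Real.exp_add]
  simp_rw [heq]
  rw [integral_add hi.restrict (hsmall.const_mul _), integral_const_mul, hd]
  congr 2; ring

lemma exists_measure_lintegral_pow_eq_exp_levy (b : ℝ) {Pim : Measure ℝ}
    (hmin : Integrable (fun r : ℝ => min 1 (r ^ 2)) Pim)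
    (hi : ∀ n : ℕ, Integrable (levyIntegrand n) Pim) :
    ∃ μ : Measure ℝ≥0, IsProbabilityMeasure μ ∧ ∀ n : ℕ, ∫⁻ x, (x : ℝ≥0∞) ^ n ∂μ =
      ENNReal.ofReal (Real.exp (b * n + ∫ r, levyIntegrand n r ∂Pim)) := by
  have hlim : ∀ n : ℕ, Tendsto (fun k => Real.exp (b * n +
      ∫ r in largeJumps k, levyIntegrand n r ∂Pim)) atTop
      (𝓝 (Real.exp (b * n + ∫ r, levyIntegrand n r ∂Pim))) := fun n =>
    (Real.continuous_exp.tendsto _).comp ((tendsto_setIntegral_largeJumps (hi n)).const_add _)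
  choose C hC using fun n => (hlim n).bddAbove_range
  have := isProbabilityMeasure_truncatedLevyLaw b hmin
  refine exists_measure_of_tendsto_moments (truncatedLevyLaw b Pim) _ (fun n => (C n).toNNReal)
    (fun n k => ?_) fun n => ?_
  · rw [lintegral_pow_truncatedLevyLaw b hmin n (hi n)]
    exact ENNReal.ofReal_le_ofReal (hC n (mem_range_self k))
  · simp_rw [lintegral_pow_truncatedLevyLaw b hmin n (hi n)]
    exact ENNReal.tendsto_ofReal (hlim n)

/-- The law of `exp X * Y` for independent `X` and `Y` with laws `D` and `ρ`. -/
def expMulLaw (D : Measure ℝ) (ρ : Measure ℝ≥0) : Measure ℝ :=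
  (D.prod ρ).map fun p => Real.exp p.1 * p.2

lemma expMulLaw_Iio_zero (D : Measure ℝ) (ρ : Measure ℝ≥0) : expMulLaw D ρ (Iio 0) = 0 := by
  rw [expMulLaw, Measure.map_apply (by fun_prop) measurableSet_Iio]
  convert measure_empty (μ := D.prod ρ)
  refine eq_empty_of_forall_notMem fun p hp => ?_
  exact absurd (mul_nonneg (Real.exp_nonneg p.1) p.2.2) (not_le.2 hp)

lemma lintegral_rpow_expMulLaw (D : Measure ℝ) (ρ : Measure ℝ≥0) [SFinite ρ] {v : ℝ}
    (hv : 0 ≤ v) :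
    ∫⁻ x, ENNReal.ofReal x ^ v ∂(expMulLaw D ρ) =
      (∫⁻ x, ENNReal.ofReal (Real.exp (v * x)) ∂D) * ∫⁻ y, (y : ℝ≥0∞) ^ v ∂ρ := by
  rw [expMulLaw, lintegral_map (by fun_prop) (by fun_prop), lintegral_prod _ (by fun_prop),
    ← lintegral_mul_const _ (by fun_prop)]
  refine lintegral_congr fun x => ?_
  rw [← lintegral_const_mul _ (by fun_prop)]
  refine lintegral_congr fun y => ?_
  simp only
  rw [ENNReal.ofReal_mul (Real.exp_nonneg _), ENNReal.mul_rpow_of_nonneg _ _ hv,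
    ENNReal.ofReal_rpow_of_pos (Real.exp_pos _), ← Real.exp_mul, mul_comm x v,
    ENNReal.ofReal_coe_nnreal]

lemma integrable_pow_and_integral_eq_of_lintegral {μ : Measure ℝ} (hμ : μ (Iio 0) = 0) {n : ℕ}
    {a : ℝ} (ha : 0 ≤ a) (h : ∫⁻ x, ENNReal.ofReal x ^ n ∂μ = ENNReal.ofReal a) :
    Integrable (fun x => x ^ n) μ ∧ ∫ x, x ^ n ∂μ = a := by
  have hpos : ∀ᵐ x ∂μ, 0 ≤ x := by
    simp only [ae_iff, not_le]; exact hμ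
  have hpow : 0 ≤ᵐ[μ] fun x => x ^ n := hpos.mono fun x hx => pow_nonneg hx n
  have h' : ∫⁻ x, ENNReal.ofReal (x ^ n) ∂μ = ENNReal.ofReal a := by
    rw [← h]
    exact lintegral_congr_ae (hpos.mono fun x hx => ENNReal.ofReal_pow hx n)
  refine ⟨⟨by fun_prop, ?_⟩, ?_⟩
  · rw [hasFiniteIntegral_iff_ofReal hpow, h']
    exact ENNReal.ofReal_lt_top
  · rw [integral_eq_lintegral_of_nonneg_ae hpow (by fun_prop), h', ENNReal.toReal_ofReal ha]

/-- **Theorem 2.1(1)**: for a Lévy process with Gaussian component `σ² > 0` admitting all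
exponential moments, the law of `e^{Y_t}` (a measure on `[0,∞)` with moments `e^{tΨ(n)}`)
is moment indeterminate for every `t > 0`. -/
theorem logLevy_gaussian_indeterminate
    (b σ : ℝ) (hσ : 0 < σ)
    (Pim : Measure ℝ) [SigmaFinite Pim] (hPi0 : Pim {0} = 0)
    (hPiint : ∫⁻ r, ENNReal.ofReal (min 1 (r ^ 2)) ∂Pim < ⊤)
    (hPiexp : ∀ u : ℝ, 0 ≤ u → ∫⁻ r in Ioi (1:ℝ), ENNReal.ofReal (Real.exp (u * r)) ∂Pim < ⊤)
    (Ψ : ℝ → ℝ)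
    (hΨ : ∀ u : ℝ, 0 ≤ u → Ψ u = b * u + σ ^ 2 * u ^ 2 / 2 +
      ∫ r, (Real.exp (u * r) - 1 - (if |r| ≤ 1 then u * r else 0)) ∂Pim)
    (t : ℝ) (ht : 0 < t)
    (ν : Measure ℝ) [IsProbabilityMeasure ν] (hsupp : SupportIsIci ν)
    (hmom : ∀ n : ℕ, Integrable (fun x => x ^ n) ν)
    (hM : ∀ n : ℕ, Mnu ν n = Real.exp (t * Ψ (n : ℝ))) :
    MomentIndeterminate ν := by
  intro hdet
  have hmin : Integrable (fun r : ℝ => min 1 (r ^ 2)) Pim := by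
    refine ⟨by fun_prop, ?_⟩
    rwa [hasFiniteIntegral_iff_ofReal (ae_of_all _ fun r => by positivity)]
  have hi : ∀ n : ℕ, Integrable (levyIntegrand n) Pim := fun n => by
    refine integrable_levyIntegrand n.cast_nonneg hmin ⟨by fun_prop, ?_⟩
    rw [hasFiniteIntegral_iff_ofReal (ae_of_all _ fun r => Real.exp_nonneg _)]
    exact hPiexp n n.cast_nonneg
  obtain ⟨ρ, hρ, hρm⟩ := exists_measure_lintegral_pow_eq_exp_levy (t * b)
    (Pim := ENNReal.ofReal t • Pim) (hmin.smul_measure ENNReal.ofReal_ne_top)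
    (fun n => (hi n).smul_measure ENNReal.ofReal_ne_top)
  set w : ℝ≥0 := (t * σ ^ 2).toNNReal with hw_def
  have hw : 0 < w := Real.toNNReal_pos.2 (by positivity)
  have hwR : (w : ℝ) = t * σ ^ 2 := Real.coe_toNNReal _ (by positivity)
  have hw' : (0 : ℝ) < w := by exact_mod_cast hw
  have hfactor : ∀ D : Measure ℝ, (∀ n : ℕ, ∫⁻ x, ENNReal.ofReal (Real.exp (n * x)) ∂D =
      ENNReal.ofReal (Real.exp (w * n ^ 2 / 2))) → expMulLaw D ρ = ν := by
    intro D hD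
    have key : ∀ n : ℕ, Integrable (fun x => x ^ n) (expMulLaw D ρ) ∧
        ∫ x, x ^ n ∂(expMulLaw D ρ) = Real.exp (t * Ψ n) := by
      intro n
      refine integrable_pow_and_integral_eq_of_lintegral (expMulLaw_Iio_zero D ρ)
        (Real.exp_nonneg _) ?_
      have h := lintegral_rpow_expMulLaw D ρ (v := n) n.cast_nonneg
      simp only [ENNReal.rpow_natCast] at h
      rw [h, hD, hρm, ← ENNReal.ofReal_mul (Real.exp_nonneg _), ← Real.exp_add,
        integral_smul_measure, ENNReal.toReal_ofReal ht.le, hΨ n n.cast_nonneg, hwR, smul_eq_mul]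
      unfold levyIntegrand
      congr 2; ring
    exact hdet _ (expMulLaw_Iio_zero D ρ) (fun n => (key n).1)
      fun n => (key n).2.trans (hM n).symm
  have hlattice := isProbabilityMeasure_latticeGaussian hw'
  refine latticeGaussian_ne_gaussianReal hw (ext_of_lintegral_exp_eq
    (integrableExpSet_latticeGaussian hw') integrableExpSet_id_gaussianReal fun v hv => ?_)
  have heq : expMulLaw (latticeGaussian w) ρ = expMulLaw (gaussianReal 0 w) ρ :=
    (hfactor _ fun n => by exact_mod_cast lintegral_exp_latticeGaussian hw' n).trans
      (hfactor _ fun n => lintegral_exp_gaussianReal w n).symm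
  have hv_eq := lintegral_rpow_expMulLaw (latticeGaussian w) ρ hv.1.le
  rw [heq, lintegral_rpow_expMulLaw _ _ hv.1.le] at hv_eq
  have hρ1 := hρm 1
  simp only [pow_one] at hρ1
  refine ((ENNReal.mul_left_inj ?_ ?_).1 hv_eq).symm
  · intro h0
    rw [lintegral_eq_zero_iff (by fun_prop)] at h0
    have hzero : ∫⁻ y, (y : ℝ≥0∞) ∂ρ = 0 := by
      rw [lintegral_eq_zero_iff (by fun_prop)]
      exact h0.mono fun y hy => ((ENNReal.rpow_eq_zero_iff_of_pos hv.1).1 hy)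
    rw [hzero] at hρ1
    exact absurd hρ1.symm (ENNReal.ofReal_pos.2 (Real.exp_pos _)).ne'
  · refine ne_top_of_le_ne_top (b := 1 + ∫⁻ y, (y : ℝ≥0∞) ∂ρ) ?_ ?_
    · rw [hρ1]; exact ENNReal.add_ne_top.2 ⟨ENNReal.one_ne_top, ENNReal.ofReal_ne_top⟩
    · calc ∫⁻ y, (y : ℝ≥0∞) ^ v ∂ρ ≤ ∫⁻ y, (1 + (y : ℝ≥0∞)) ∂ρ := by
            refine lintegral_mono fun y => ?_
            rcases le_total (y : ℝ≥0∞) 1 with h | h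
            · exact (ENNReal.rpow_le_one h hv.1.le).trans le_self_add
            · exact (ENNReal.rpow_le_rpow_of_exponent_le h hv.2.le).trans
                ((ENNReal.rpow_one _).le.trans le_add_self)
        _ = 1 + ∫⁻ y, (y : ℝ≥0∞) ∂ρ := by
            rw [lintegral_add_left measurable_const]; simp
end
end

section
/- Fix t > 0 and let ν be a probability measure on [0,∞) with support equal to [0,∞) whose moments satisfy ∫₀^∞ xⁿ dν(x) = (n+1)^{tn} for every integer n ≥ 0 (i.e. the moment sequence is e^{tΨ(n)} with Ψ(u) = u·log(u+1)). Then ν is moment determinate if and only if t ≤ 2. -/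
open MeasureTheory Set Filter

noncomputable section

open scoped ENNReal

lemma ae_nonneg_of_Iio_null {μ : Measure ℝ} (hμ : μ (Iio (0 : ℝ)) = 0) : ∀ᵐ x ∂μ, 0 ≤ x := by
  rw [ae_iff]
  simp only [not_le]
  exact hμ

/-- The image of a measure under `√` plus its mirror image. -/
def sqrtSymmetrization (μ : Measure ℝ) : Measure ℝ :=
  μ.map Real.sqrt + μ.map (fun x => -Real.sqrt x)

instance (μ : Measure ℝ) [IsFiniteMeasure μ] : IsFiniteMeasure (sqrtSymmetrization μ) := by
  unfold sqrtSymmetrization; infer_instance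

lemma map_sq_sqrtSymmetrization (μ : Measure ℝ) (hμ : μ (Iio (0 : ℝ)) = 0) :
    (sqrtSymmetrization μ).map (fun x => x ^ 2) = μ + μ := by
  have hae := ae_nonneg_of_Iio_null hμ
  unfold sqrtSymmetrization
  rw [Measure.map_add _ _ (by fun_prop), Measure.map_map (by fun_prop) (by fun_prop),
    Measure.map_map (by fun_prop) (by fun_prop)]
  congr 1
  all_goals
    conv_rhs => rw [← Measure.map_id (μ := μ)]
    refine Measure.map_congr ?_
    filter_upwards [hae] with x hx
    simp [Real.sq_sqrt hx]

lemma lintegral_exp_sqrtSymmetrization (μ : Measure ℝ) (hμ : μ (Iio (0 : ℝ)) = 0)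
    (hmom : ∀ n : ℕ, Integrable (fun x => x ^ n) μ) (s : ℝ) :
    ∫⁻ x, ENNReal.ofReal (Real.exp (s * x)) ∂(sqrtSymmetrization μ) =
      ∑' n : ℕ, ENNReal.ofReal (2 * (s ^ (2 * n) / (2 * n).factorial) * Mnu μ n) := by
  have hae := ae_nonneg_of_Iio_null hμ
  have hc (n : ℕ) : 0 ≤ 2 * (s ^ (2 * n) / (2 * n).factorial) := by
    rw [pow_mul]; positivity
  unfold sqrtSymmetrization
  rw [lintegral_add_measure, lintegral_map (by fun_prop) (by fun_prop),
    lintegral_map (by fun_prop) (by fun_prop), ← lintegral_add_left (by fun_prop)]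
  have h1 : ∀ᵐ x ∂μ, ENNReal.ofReal (Real.exp (s * √x)) + ENNReal.ofReal (Real.exp (s * -√x)) =
      ∑' n : ℕ, ENNReal.ofReal (2 * (s ^ (2 * n) / (2 * n).factorial) * x ^ n) := by
    filter_upwards [hae] with x hx
    have hs : HasSum (fun n : ℕ => 2 * (s ^ (2 * n) / (2 * n).factorial) * x ^ n)
        (Real.exp (s * √x) + Real.exp (s * -√x)) := by
      have := (Real.hasSum_cosh (s * √x)).mul_left 2
      rw [Real.cosh_eq, mul_div_cancel₀ _ two_ne_zero, ← mul_neg] at this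
      have he (n : ℕ) : 2 * (s ^ (2 * n) / (2 * n).factorial) * x ^ n =
          2 * ((s * √x) ^ (2 * n) / (2 * n).factorial) := by
        rw [mul_pow, pow_mul (√x), Real.sq_sqrt hx]
        ring
      simpa only [he] using this
    rw [← ENNReal.ofReal_add (by positivity) (by positivity), ← hs.tsum_eq,
      ENNReal.ofReal_tsum_of_nonneg _ hs.summable]
    intro n
    exact mul_nonneg (hc n) (by positivity)
  rw [lintegral_congr_ae h1, lintegral_tsum (by fun_prop)]
  congr 1 with n
  rw [Mnu, ← integral_const_mul, ofReal_integral_eq_lintegral_ofReal]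
  · exact (hmom n).const_mul _
  · filter_upwards [hae] with x hx
    exact mul_nonneg (hc n) (by positivity)

lemma integrable_exp_iff_lintegral_ne_top (ρ : Measure ℝ) (s : ℝ) :
    Integrable (fun x => Real.exp (s * x)) ρ ↔
      ∫⁻ x, ENNReal.ofReal (Real.exp (s * x)) ∂ρ ≠ ∞ := by
  rw [← lt_top_iff_ne_top, Integrable, hasFiniteIntegral_iff_ofReal
    (ae_of_all _ fun x => (Real.exp_pos _).le)]
  exact and_iff_right (by fun_prop)

/-- Finite measures on `ℝ` with the same exponential moments, finite at `±c`, are equal. -/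
lemma eq_of_lintegral_exp_eq {ρ₁ ρ₂ : Measure ℝ} [IsFiniteMeasure ρ₁] [IsFiniteMeasure ρ₂]
    (h : ∀ s : ℝ, ∫⁻ x, ENNReal.ofReal (Real.exp (s * x)) ∂ρ₁ =
      ∫⁻ x, ENNReal.ofReal (Real.exp (s * x)) ∂ρ₂)
    {c : ℝ} (hc : 0 < c) (h1 : ∫⁻ x, ENNReal.ofReal (Real.exp (c * x)) ∂ρ₁ ≠ ∞)
    (h2 : ∫⁻ x, ENNReal.ofReal (Real.exp (-c * x)) ∂ρ₁ ≠ ∞) : ρ₁ = ρ₂ := by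
  have hmgf : ProbabilityTheory.mgf id ρ₁ = ProbabilityTheory.mgf id ρ₂ := by
    ext s
    simp only [ProbabilityTheory.mgf, id]
    rw [integral_eq_lintegral_of_nonneg_ae (ae_of_all _ fun x => (Real.exp_pos _).le)
      (by fun_prop), integral_eq_lintegral_of_nonneg_ae
      (ae_of_all _ fun x => (Real.exp_pos _).le) (by fun_prop), h s]
  have h0 : ρ₁ = 0 ↔ ρ₂ = 0 := by
    have := h 0
    simp only [zero_mul, Real.exp_zero, ENNReal.ofReal_one, lintegral_one] at this
    rw [← Measure.measure_univ_eq_zero, this, Measure.measure_univ_eq_zero]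
  have hint : (0 : ℝ) ∈ interior (ProbabilityTheory.integrableExpSet id ρ₁) := by
    rw [mem_interior]
    refine ⟨Ioo (-c) c, ?_, isOpen_Ioo, by simp [hc]⟩
    refine Ioo_subset_Icc_self.trans
      (ProbabilityTheory.convex_integrableExpSet.ordConnected.out ?_ ?_)
    · exact (integrable_exp_iff_lintegral_ne_top _ _).2 h2
    · exact (integrable_exp_iff_lintegral_ne_top _ _).2 h1
  have heq := ProbabilityTheory.eqOn_complexMGF_of_mgf' hmgf h0
  refine Measure.ext_of_charFun ?_
  ext y
  rw [← ProbabilityTheory.complexMGF_id_mul_I, ← ProbabilityTheory.complexMGF_id_mul_I]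
  exact heq (by simpa using hint)

lemma measure_add_self_cancel {μ ν : Measure ℝ} (h : μ + μ = ν + ν) : μ = ν := by
  ext s _
  have := congrArg (fun m : Measure ℝ => m s) h
  simp only [Measure.add_apply, ← two_mul] at this
  exact (ENNReal.mul_right_inj (by simp) (by simp)).1 this

theorem momentDeterminate_of_moments_le {ν : Measure ℝ} [IsFiniteMeasure ν]
    (hν : ν (Iio (0 : ℝ)) = 0) (hmom : ∀ n : ℕ, Integrable (fun x => x ^ n) ν)
    (hM : ∀ n : ℕ, Mnu ν n ≤ ((n : ℝ) + 1) ^ (2 * n)) : MomentDeterminate ν := by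
  intro μ hμ hμm hμM
  have hfin : IsFiniteMeasure μ := by
    have := hμm 0
    simp only [pow_zero] at this
    exact (integrable_const_iff_isFiniteMeasure one_ne_zero).1 this
  have hbd (s : ℝ) (hs : s ^ 2 = 1 / 4) :
      ∫⁻ x, ENNReal.ofReal (Real.exp (s * x)) ∂(sqrtSymmetrization μ) ≠ ∞ := by
    rw [lintegral_exp_sqrtSymmetrization μ hμ hμm]
    have hsum : Summable fun n : ℕ => 2 * Real.exp 1 * (Real.exp 1 / 4) ^ n :=
      (summable_geometric_of_lt_one (by positivity)
        (by linarith [Real.exp_one_lt_d9])).mul_left _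
    refine ne_top_of_le_ne_top hsum.tsum_ofReal_ne_top (ENNReal.tsum_le_tsum fun n => ?_)
    refine ENNReal.ofReal_le_ofReal ?_
    rw [hμM n, pow_mul, hs]
    have h1 := Real.pow_div_factorial_le_exp ((n : ℝ) + 1) (by positivity) (2 * n)
    rw [Real.exp_add] at h1
    calc 2 * ((1 / 4 : ℝ) ^ n / (2 * n).factorial) * Mnu ν n
        ≤ 2 * ((1 / 4 : ℝ) ^ n / (2 * n).factorial) * ((n : ℝ) + 1) ^ (2 * n) := by
          gcongr; exact hM n
      _ = 2 * (1 / 4 : ℝ) ^ n * (((n : ℝ) + 1) ^ (2 * n) / (2 * n).factorial) := by ring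
      _ ≤ 2 * (1 / 4 : ℝ) ^ n * (Real.exp n * Real.exp 1) := by gcongr
      _ = 2 * Real.exp 1 * (Real.exp 1 / 4) ^ n := by
          rw [← Real.exp_one_pow, div_pow, div_pow, one_pow]; ring
  have key : sqrtSymmetrization μ = sqrtSymmetrization ν := by
    refine eq_of_lintegral_exp_eq (fun s => ?_) (c := 1 / 2) (by norm_num)
      (hbd _ (by norm_num)) (hbd _ (by norm_num))
    rw [lintegral_exp_sqrtSymmetrization μ hμ hμm, lintegral_exp_sqrtSymmetrization ν hν hmom]
    simp only [hμM]
  apply measure_add_self_cancel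
  rw [← map_sq_sqrtSymmetrization μ hμ, ← map_sq_sqrtSymmetrization ν hν, key]

/-- The increment `g z - g (z + 1)` of the Binet-type remainder
`g z = z log z - z + log √(2π) - log Γ(z + 1/2)`. -/
def binetIncrement (z : ℝ) : ℝ :=
  1 + Real.log (z + 1 / 2) + z * Real.log z - (z + 1) * Real.log (z + 1)

/-- The coefficients of `binetIncrement z` as a power series in `(2 * z + 1) ^ (-2)`. -/
def binetCoeff (k : ℕ) : ℝ := 1 / (2 * (k + 1)) - 1 / (2 * (k + 1) + 1)

lemma binetCoeff_nonneg (k : ℕ) : 0 ≤ binetCoeff k := by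
  unfold binetCoeff
  rw [sub_nonneg]
  gcongr
  linarith

lemma hasSum_binetIncrement {z : ℝ} (hz : 0 < z) :
    HasSum (fun k : ℕ => binetCoeff k * (1 / (2 * z + 1)) ^ (2 * (k + 1)))
      (binetIncrement z) := by
  set x : ℝ := 1 / (2 * z + 1) with hx
  have hx0 : 0 < x := by positivity
  have hx1 : x < 1 := by rw [hx, div_lt_one (by positivity)]; linarith
  have h1 := Real.hasSum_log_sub_log_of_abs_lt_one (x := x) (by rwa [abs_of_pos hx0])
  have h2 := Real.hasSum_pow_div_log_of_abs_lt_one (x := x ^ 2)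
    (by rw [abs_of_pos (by positivity)]; exact pow_lt_one₀ hx0.le hx1 two_ne_zero)
  have h3 := (hasSum_nat_add_iff' 1).2 (h1.mul_left (1 / (2 * x)))
  have h4 := (h2.mul_left (1 / 2)).sub h3
  have e1 : Real.log (1 + x) = Real.log 2 + Real.log (z + 1) - Real.log (2 * z + 1) := by
    rw [← Real.log_mul (by norm_num) (by positivity), ← Real.log_div (by positivity)
      (by positivity)]
    congr 1
    rw [hx]; field_simp; ring
  have e2 : Real.log (1 - x) = Real.log 2 + Real.log z - Real.log (2 * z + 1) := by
    rw [← Real.log_mul (by norm_num) (by positivity), ← Real.log_div (by positivity)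
      (by positivity)]
    congr 1
    rw [hx]; field_simp; ring
  have e3 : Real.log (z + 1 / 2) = Real.log (2 * z + 1) - Real.log 2 := by
    rw [← Real.log_div (by positivity) (by norm_num)]
    congr 1; ring
  have e4 : Real.log (1 - x ^ 2) = Real.log (1 + x) + Real.log (1 - x) := by
    rw [← Real.log_mul (by positivity) (by linarith)]
    congr 1; ring
  have e5 : 1 / (2 * x) = z + 1 / 2 := by rw [hx]; field_simp
  have key : 1 / 2 * -Real.log (1 - x ^ 2) - (1 / (2 * x) * (Real.log (1 + x) - Real.log (1 - x)) -
      ∑ i ∈ Finset.range 1, 1 / (2 * x) * (2 * (1 / (2 * (i : ℝ) + 1)) * x ^ (2 * i + 1))) =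
      binetIncrement z := by
    have e6 : ∑ i ∈ Finset.range 1, 1 / (2 * x) * (2 * (1 / (2 * (i : ℝ) + 1)) * x ^ (2 * i + 1))
        = 1 := by
      simp; field_simp
    rw [e6, e4, e5, e1, e2, binetIncrement, e3]
    ring
  rw [key] at h4
  have he (k : ℕ) : binetCoeff k * x ^ (2 * (k + 1)) =
      1 / 2 * ((x ^ 2) ^ (k + 1) / (k + 1)) -
        1 / (2 * x) * (2 * (1 / (2 * ((k + 1 : ℕ) : ℝ) + 1)) * x ^ (2 * (k + 1) + 1)) := by
    unfold binetCoeff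
    push_cast
    rw [← pow_mul, pow_succ x (2 * (k + 1))]
    field_simp
  simpa only [he] using h4

lemma binetIncrement_nonneg {z : ℝ} (hz : 0 < z) : 0 ≤ binetIncrement z :=
  (hasSum_binetIncrement hz).nonneg fun k => mul_nonneg (binetCoeff_nonneg k) (by positivity)

lemma sum_range_binetIncrement {z : ℝ} (N : ℕ) :
    ∑ j ∈ Finset.range N, binetIncrement (z + j) =
      N + ∑ j ∈ Finset.range N, Real.log (z + 1 / 2 + j) + z * Real.log z -
        (z + N) * Real.log (z + N) := by
  induction N with
  | zero => simp
  | succ N ih =>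
    rw [Finset.sum_range_succ, ih, Finset.sum_range_succ, binetIncrement]
    push_cast
    rw [show z + N + 1 / 2 = z + 1 / 2 + (N : ℝ) by ring,
      show z + (N + 1) = z + (N : ℝ) + 1 by ring]
    ring

lemma log_GammaSeq {s : ℝ} (hs : 0 < s) {n : ℕ} (hn : n ≠ 0) :
    Real.log (Real.GammaSeq s n) = s * Real.log n + Real.log n.factorial -
      ∑ j ∈ Finset.range (n + 1), Real.log (s + j) := by
  have hn' : (0 : ℝ) < n := by positivity
  rw [Real.GammaSeq, Real.log_div (by positivity) (Finset.prod_ne_zero_iff.2 fun j _ => by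
    positivity), Real.log_mul (by positivity) (by positivity), Real.log_rpow hn',
    Real.log_prod fun j _ => by positivity]

lemma tendsto_add_mul_log_ratio {a : ℝ} (ha : 0 < a) :
    Tendsto (fun n : ℕ => (a + n) * (Real.log (a + n) - Real.log n)) atTop (nhds a) := by
  have h1 : Tendsto (fun n : ℕ => (n : ℝ) * Real.log (1 + a / n)) atTop (nhds a) :=
    (Real.tendsto_mul_log_one_add_div_atTop a).comp tendsto_natCast_atTop_atTop
  have h2 : Tendsto (fun n : ℕ => a * Real.log (1 + a / n)) atTop (nhds 0) := by
    have h3 : Tendsto (fun n : ℕ => 1 + a / (n : ℝ)) atTop (nhds 1) := by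
      simpa using (tendsto_const_div_atTop_nhds_zero_nat a).const_add 1
    simpa using (h3.log one_ne_zero).const_mul a
  have h4 := h1.add h2
  rw [add_zero] at h4
  refine h4.congr' ?_
  filter_upwards [eventually_ne_atTop 0] with n hn
  have hn' : (0 : ℝ) < n := by positivity
  rw [← Real.log_div (by positivity) (by positivity), show 1 + a / n = (a + n) / n by field_simp; ring]
  ring

/-- A Binet-type expansion of `Γ(z + 1/2)`. -/
lemma hasSum_binetIncrement_add {z : ℝ} (hz : 0 < z) :
    HasSum (fun j : ℕ => binetIncrement (z + j))
      (Real.log √(2 * Real.pi) + z * Real.log z - z - Real.log (Real.Gamma (z + 1 / 2))) := by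
  rw [hasSum_iff_tendsto_nat_of_nonneg fun j => binetIncrement_nonneg (by positivity),
    ← tendsto_add_atTop_iff_nat 1]
  have hG : Tendsto (fun n => Real.log (Real.GammaSeq (z + 1 / 2) n)) atTop
      (nhds (Real.log (Real.Gamma (z + 1 / 2)))) :=
    (Real.GammaSeq_tendsto_Gamma _).log (Real.Gamma_pos_of_pos (by positivity)).ne'
  have hS : Tendsto (fun n => Real.log (Stirling.stirlingSeq n)) atTop
      (nhds (Real.log √Real.pi)) :=
    Stirling.tendsto_stirlingSeq_sqrt_pi.log (by positivity)
  have hL := tendsto_add_mul_log_ratio (a := z + 1) (by positivity)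
  have := ((hS.sub hL).sub hG).add_const (1 + Real.log 2 / 2 + z * Real.log z)
  have hlim : Real.log √Real.pi - (z + 1) - Real.log (Real.Gamma (z + 1 / 2)) +
      (1 + Real.log 2 / 2 + z * Real.log z) =
      Real.log √(2 * Real.pi) + z * Real.log z - z - Real.log (Real.Gamma (z + 1 / 2)) := by
    rw [Real.log_sqrt (by positivity), Real.log_sqrt (by positivity),
      Real.log_mul (by norm_num) (by positivity)]
    ring
  rw [hlim] at this
  refine this.congr' ?_
  filter_upwards [eventually_ne_atTop 0] with n hn
  have hn' : (0 : ℝ) < n := by positivity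
  rw [sum_range_binetIncrement, log_GammaSeq (by positivity) hn, Stirling.log_stirlingSeq_formula,
    Real.log_div (by positivity) (Real.exp_ne_zero _), Real.log_exp,
    Real.log_mul (by norm_num) (by positivity)]
  push_cast
  rw [show z + 1 + (n : ℝ) = z + (n + 1) by ring]
  ring

/-- `A` is the sequence of exponential moments of an s-finite measure on `ℝ`. -/
def IsExpMoment (A : ℕ → ℝ≥0∞) : Prop :=
  ∃ ρ : Measure ℝ, SFinite ρ ∧ ∀ n : ℕ, ∫⁻ s, ENNReal.ofReal (Real.exp (n * s)) ∂ρ = A n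

namespace IsExpMoment

lemma geometric (c : ℝ≥0∞) {r : ℝ} (hr : 0 < r) :
    IsExpMoment fun n => c * ENNReal.ofReal (r ^ n) := by
  refine ⟨c • Measure.dirac (Real.log r), inferInstance, fun n => ?_⟩
  rw [lintegral_smul_measure, lintegral_dirac' _ (by fun_prop), Real.exp_nat_mul, Real.exp_log hr,
    smul_eq_mul]

lemma const (c : ℝ≥0∞) : IsExpMoment fun _ => c := by
  simpa using geometric c one_pos

lemma mul {A B : ℕ → ℝ≥0∞} (hA : IsExpMoment A) (hB : IsExpMoment B) :
    IsExpMoment fun n => A n * B n := by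
  obtain ⟨ρ, _, hρ⟩ := hA
  obtain ⟨σ, _, hσ⟩ := hB
  refine ⟨(ρ.prod σ).map fun p => p.1 + p.2, inferInstance, fun n => ?_⟩
  simp only [← hρ, ← hσ]
  rw [lintegral_map (by fun_prop) (by fun_prop), ← lintegral_prod_mul (by fun_prop) (by fun_prop)]
  refine lintegral_congr fun p => ?_
  rw [← ENNReal.ofReal_mul (by positivity), ← Real.exp_add, mul_add]

lemma tsum {A : ℕ → ℕ → ℝ≥0∞} (hA : ∀ j, IsExpMoment (A j)) :
    IsExpMoment fun n => ∑' j, A j n := by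
  choose ρ hρ h using hA
  refine ⟨Measure.sum ρ, inferInstance, fun n => ?_⟩
  simp only [lintegral_sum_measure, h]

lemma pow {A : ℕ → ℝ≥0∞} (hA : IsExpMoment A) (m : ℕ) : IsExpMoment fun n => A n ^ m := by
  induction m with
  | zero => simpa using const 1
  | succ m ih => simpa only [pow_succ] using ih.mul hA

lemma exp {f : ℕ → ℝ} (hf : ∀ n, 0 ≤ f n) (h : IsExpMoment fun n => ENNReal.ofReal (f n)) :
    IsExpMoment fun n => ENNReal.ofReal (Real.exp (f n)) := by
  have key := tsum fun m => (const (ENNReal.ofReal (1 / m.factorial))).mul (h.pow m)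
  convert key using 2 with n
  rw [Real.exp_eq_exp_ℝ, NormedSpace.exp_eq_tsum_div, ENNReal.ofReal_tsum_of_nonneg
    (fun m => div_nonneg (pow_nonneg (hf n) _) (by positivity))
    (NormedSpace.expSeries_div_summable (f n))]
  congr 1 with m
  rw [← ENNReal.ofReal_pow (hf n), ← ENNReal.ofReal_mul (by positivity)]
  congr 1
  ring

end IsExpMoment

lemma integrableOn_rpow_mul_exp_neg_mul {a r : ℝ} (ha : 0 < a) (hr : 0 < r) :
    IntegrableOn (fun u : ℝ => u ^ (a - 1) * Real.exp (-(r * u))) (Ioi 0) := by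
  refine Integrable.of_integral_ne_zero ?_
  rw [Real.integral_rpow_mul_exp_neg_mul_Ioi ha hr]
  have := Real.Gamma_pos_of_pos ha
  positivity

namespace IsExpMoment

lemma inv_rpow {a p : ℝ} (ha : 0 < a) (hp : 0 < p) :
    IsExpMoment fun n => ENNReal.ofReal ((1 / (n + a)) ^ p) := by
  have hG := Real.Gamma_pos_of_pos hp
  refine ⟨((volume.restrict (Ioi 0)).withDensity fun s => ENNReal.ofReal
    ((Real.Gamma p)⁻¹ * (s ^ (p - 1) * Real.exp (-(a * s))))).map Neg.neg, inferInstance,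
    fun n => ?_⟩
  have hna : 0 < n + a := by positivity
  rw [lintegral_map (by fun_prop) (by fun_prop),
    lintegral_withDensity_eq_lintegral_mul _ (by fun_prop) (by fun_prop)]
  have h1 : (1 / (n + a)) ^ p = (Real.Gamma p)⁻¹ *
      ∫ s in Ioi 0, s ^ (p - 1) * Real.exp (-((n + a) * s)) := by
    rw [Real.integral_rpow_mul_exp_neg_mul_Ioi hp hna]
    field_simp
  simp only [h1]
  rw [← integral_const_mul, ofReal_integral_eq_lintegral_ofReal
    ((integrableOn_rpow_mul_exp_neg_mul hp hna).const_mul _)]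
  · refine lintegral_congr fun s => ?_
    simp only [Pi.mul_apply]
    rw [← ENNReal.ofReal_mul' (by positivity)]
    congr 1
    rw [mul_assoc, mul_assoc, ← Real.exp_add]
    ring_nf
  · filter_upwards [ae_restrict_mem measurableSet_Ioi] with s hs
    have : 0 < s := hs
    positivity

end IsExpMoment

/-- The quotient of `(n + 1) ^ (t * n)` by `Γ(t * n + t + 1/2)` is a sequence of exponential
moments. -/
lemma isExpMoment_div_Gamma {t : ℝ} (ht : 0 < t) :
    IsExpMoment fun n => ENNReal.ofReal
      (((n : ℝ) + 1) ^ (t * n) / Real.Gamma (t * n + (t + 1 / 2))) := by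
  have hG : IsExpMoment fun n => ∑' j : ℕ, ∑' k : ℕ, ENNReal.ofReal
      (binetCoeff k * (1 / (2 * (t * (n + 1) + j) + 1)) ^ (2 * (k + 1))) := by
    refine IsExpMoment.tsum fun j => IsExpMoment.tsum fun k => ?_
    have h := (IsExpMoment.const (ENNReal.ofReal
      (binetCoeff k * (1 / (2 * t)) ^ (2 * (k + 1))))).mul
      (IsExpMoment.inv_rpow (a := 1 + (2 * j + 1) / (2 * t)) (p := (2 * (k + 1) : ℕ))
        (by positivity) (by positivity))
    convert h using 2 with n
    rw [← ENNReal.ofReal_mul (mul_nonneg (binetCoeff_nonneg k) (by positivity)),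
      Real.rpow_natCast, mul_assoc, ← mul_pow]
    congr 3
    field_simp
    ring
  set g : ℝ → ℝ := fun z => Real.log √(2 * Real.pi) + z * Real.log z - z -
    Real.log (Real.Gamma (z + 1 / 2)) with hg
  have hsum (n : ℕ) : HasSum (fun j : ℕ => binetIncrement (t * (n + 1) + j)) (g (t * (n + 1))) :=
    hasSum_binetIncrement_add (by positivity)
  have hg0 (n : ℕ) : 0 ≤ g (t * (n + 1)) :=
    (hsum n).nonneg fun j => binetIncrement_nonneg (by positivity)
  have hGg : IsExpMoment fun n => ENNReal.ofReal (g (t * (n + 1))) := by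
    convert hG using 2 with n
    rw [← (hsum n).tsum_eq, ENNReal.ofReal_tsum_of_nonneg
      (fun j => binetIncrement_nonneg (by positivity)) (hsum n).summable]
    congr 1 with j
    have hj := hasSum_binetIncrement (z := t * (n + 1) + j) (by positivity)
    rw [← hj.tsum_eq, ENNReal.ofReal_tsum_of_nonneg
      (fun k => mul_nonneg (binetCoeff_nonneg k) (by positivity)) hj.summable]
  have h := ((IsExpMoment.exp hg0 hGg).mul (IsExpMoment.inv_rpow one_pos ht)).mul
    (IsExpMoment.geometric (ENNReal.ofReal (Real.exp (t - t * Real.log t - Real.log √(2 * Real.pi))))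
      (r := Real.exp (t - t * Real.log t)) (Real.exp_pos _))
  convert h using 2 with n
  have hz : 0 < t * ((n : ℝ) + 1) := by positivity
  have hΓ : 0 < Real.Gamma (t * n + (t + 1 / 2)) := Real.Gamma_pos_of_pos (by positivity)
  have hn : (0 : ℝ) < (n : ℝ) + 1 := by positivity
  rw [← ENNReal.ofReal_mul (by positivity), ← ENNReal.ofReal_mul (by positivity),
    ← ENNReal.ofReal_mul (by positivity)]
  congr 1
  rw [Real.rpow_def_of_pos hn, Real.rpow_def_of_pos (by positivity), ← Real.exp_nat_mul,
    div_eq_mul_inv, ← Real.exp_log hΓ, ← Real.exp_neg, ← Real.exp_add, ← Real.exp_add,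
    ← Real.exp_add, ← Real.exp_add, one_div (_ + 1), Real.log_inv]
  congr 1
  change _ = Real.log √(2 * Real.pi) + t * (n + 1) * Real.log (t * (n + 1)) - t * (n + 1) -
    Real.log (Real.Gamma (t * (n + 1) + 1 / 2)) + _ + _
  rw [Real.log_mul ht.ne' hn.ne', show t * ((n : ℝ) + 1) + 1 / 2 = t * n + (t + 1 / 2) by ring]
  ring

/-- The unnormalised Gamma density, as a measure on `(0, ∞)`. -/
def gammaWeight (a : ℝ) : Measure ℝ :=
  (volume.restrict (Ioi 0)).withDensity fun u => ENNReal.ofReal (u ^ (a - 1) * Real.exp (-u))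

lemma integral_gammaWeight {E : Type*} [NormedAddCommGroup E] [NormedSpace ℝ E] (a : ℝ)
    (f : ℝ → E) :
    ∫ u, f u ∂(gammaWeight a) = ∫ u in Ioi 0, (u ^ (a - 1) * Real.exp (-u)) • f u := by
  unfold gammaWeight
  rw [integral_withDensity_eq_integral_toReal_smul (by fun_prop)
    (ae_of_all _ fun _ => ENNReal.ofReal_lt_top)]
  refine setIntegral_congr_fun measurableSet_Ioi fun u hu => ?_
  have : 0 < u := hu
  rw [ENNReal.toReal_ofReal (by positivity)]

lemma mgf_gammaWeight {a s : ℝ} (ha : 0 < a) (hs : s < 1) :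
    ProbabilityTheory.mgf id (gammaWeight a) s = (1 / (1 - s)) ^ a * Real.Gamma a := by
  rw [ProbabilityTheory.mgf, integral_gammaWeight,
    ← Real.integral_rpow_mul_exp_neg_mul_Ioi ha (sub_pos.2 hs)]
  refine setIntegral_congr_fun measurableSet_Ioi fun u _ => ?_
  simp only [smul_eq_mul, id]
  rw [mul_assoc, ← Real.exp_add]
  ring_nf

lemma Iio_subset_interior_integrableExpSet_gammaWeight {a : ℝ} (ha : 0 < a) :
    Iio (1 : ℝ) ⊆ interior (ProbabilityTheory.integrableExpSet id (gammaWeight a)) := by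
  refine interior_maximal (fun s hs => Integrable.of_integral_ne_zero ?_) isOpen_Iio
  have h := mgf_gammaWeight ha hs
  rw [ProbabilityTheory.mgf] at h
  rw [h]
  have := Real.Gamma_pos_of_pos ha
  have : 0 < 1 - s := sub_pos.2 hs
  positivity

lemma complexMGF_gammaWeight {a : ℝ} (ha : 0 < a) {z : ℂ} (hz : z.re < 1) :
    ProbabilityTheory.complexMGF id (gammaWeight a) z =
      (1 - z) ^ (-(a : ℂ)) * Real.Gamma a := by
  have hslit {w : ℂ} (hw : w.re < 1) : 1 - w ∈ Complex.slitPlane := by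
    left; simpa using hw
  have h1 : AnalyticOnNhd ℂ (ProbabilityTheory.complexMGF id (gammaWeight a)) {w | w.re < 1} :=
    ProbabilityTheory.analyticOnNhd_complexMGF.mono fun w hw =>
      Iio_subset_interior_integrableExpSet_gammaWeight ha hw
  have h2 : AnalyticOnNhd ℂ (fun w : ℂ => (1 - w) ^ (-(a : ℂ)) * Real.Gamma a)
      {w | w.re < 1} := fun w hw =>
    (((analyticAt_const.sub analyticAt_id).cpow analyticAt_const (hslit hw))).mul analyticAt_const
  refine h1.eqOn_of_preconnected_of_frequently_eq h2
    (convex_halfSpace_re_lt 1).isPreconnected (z₀ := 0) (by simp) ?_ hz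
  have hreal : ∃ᶠ x : ℝ in nhdsWithin 0 {0}ᶜ,
      ProbabilityTheory.complexMGF id (gammaWeight a) x =
        (1 - (x : ℂ)) ^ (-(a : ℂ)) * Real.Gamma a := by
    refine Eventually.frequently ?_
    filter_upwards [mem_nhdsWithin_of_mem_nhds (Iio_mem_nhds (zero_lt_one' ℝ))] with x hx
    have hx' : 0 < 1 - x := sub_pos.2 hx
    rw [ProbabilityTheory.complexMGF_ofReal, mgf_gammaWeight ha hx, one_div,
      Real.inv_rpow hx'.le, ← Real.rpow_neg hx'.le]
    push_cast [Complex.ofReal_cpow hx'.le]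
    rfl
  have hmap : Tendsto (fun x : ℝ => (x : ℂ)) (nhdsWithin 0 {0}ᶜ) (nhdsWithin 0 {0}ᶜ) := by
    refine tendsto_nhdsWithin_of_tendsto_nhds_of_eventually_within _ ?_ ?_
    · exact (Complex.continuous_ofReal.tendsto' 0 0 (by simp)).mono_left nhdsWithin_le_nhds
    · filter_upwards [self_mem_nhdsWithin] with x hx
      simpa using hx
  exact hmap.frequently hreal

lemma one_sub_I_mul_tan_cpow {θ : ℝ} (h1 : -(Real.pi / 2) < θ) (h2 : θ < Real.pi / 2) (a : ℝ) :
    (1 - Real.tan θ * Complex.I) ^ (-(a : ℂ)) =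
      (Real.cos θ ^ a : ℝ) * Complex.exp ((a * θ : ℝ) * Complex.I) := by
  have hc := Real.cos_pos_of_mem_Ioo ⟨h1, h2⟩
  have e : (1 - Real.tan θ * Complex.I : ℂ) =
      Complex.exp (((-Real.log (Real.cos θ) : ℝ) : ℂ) + ((-θ : ℝ) : ℂ) * Complex.I) := by
    rw [Complex.exp_add, ← Complex.ofReal_exp, Real.exp_neg, Real.exp_log hc,
      Complex.exp_mul_I, ← Complex.ofReal_cos, ← Complex.ofReal_sin, Real.cos_neg, Real.sin_neg,
      Real.tan_eq_sin_div_cos]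
    push_cast
    have : (Complex.cos θ) ≠ 0 := by exact_mod_cast hc.ne'
    field_simp
    ring
  rw [Complex.cpow_def_of_ne_zero (by rw [e]; exact Complex.exp_ne_zero _), e, Complex.log_exp]
  · rw [Real.rpow_def_of_pos hc, Complex.ofReal_exp, ← Complex.exp_add]
    congr 1
    push_cast
    ring
  · simp; linarith [Real.pi_pos]
  · simp; linarith [Real.pi_pos]

lemma integrable_gammaWeight_of_bounded {a : ℝ} (ha : 0 < a) {f : ℝ → ℝ} (hf : Continuous f)
    (hb : ∀ u, |f u| ≤ 1) :
    IntegrableOn (fun u => u ^ (a - 1) * Real.exp (-u) * f u) (Ioi 0) := by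
  have h := integrableOn_rpow_mul_exp_neg_mul ha one_pos
  simp only [one_mul] at h
  exact Integrable.mul_bdd (c := 1) h hf.aestronglyMeasurable (ae_of_all _ hb)

lemma integral_rpow_mul_exp_neg_mul_sin {a θ c : ℝ} (ha : 0 < a) (h1 : -(Real.pi / 2) < θ)
    (h2 : θ < Real.pi / 2) :
    ∫ u in Ioi 0, u ^ (a - 1) * Real.exp (-u) * Real.sin (u * Real.tan θ - c) =
      Real.Gamma a * Real.cos θ ^ a * Real.sin (a * θ - c) := by
  have h := complexMGF_gammaWeight ha (z := Real.tan θ * Complex.I) (by simp)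
  rw [one_sub_I_mul_tan_cpow h1 h2, ProbabilityTheory.complexMGF, integral_gammaWeight] at h
  have hint := Integrable.of_integral_ne_zero (h.trans_ne (by
    have hΓ := Real.Gamma_pos_of_pos ha
    have hcos := Real.rpow_pos_of_pos (Real.cos_pos_of_mem_Ioo ⟨h1, h2⟩) a
    refine mul_ne_zero (mul_ne_zero ?_ (Complex.exp_ne_zero _)) ?_
    · exact_mod_cast hcos.ne'
    · exact_mod_cast hΓ.ne'))
  have h' := congrArg (fun w => Complex.im (w * Complex.exp ((-c : ℝ) * Complex.I))) h
  simp only [← integral_mul_const] at h'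
  rw [← Complex.imCLM_apply, ← ContinuousLinearMap.integral_comp_comm _ (hint.mul_const _)] at h'
  have e1 (x y : ℝ) : Complex.exp (x * Complex.I) * Complex.exp (y * Complex.I) =
      Complex.exp ((x + y : ℝ) * Complex.I) := by
    rw [← Complex.exp_add]; push_cast; ring_nf
  have e2 (r x : ℝ) : ((r : ℂ) * Complex.exp (x * Complex.I)).im = r * Real.sin x := by
    rw [Complex.im_ofReal_mul, Complex.exp_ofReal_mul_I_im]
  calc _ = ∫ u in Ioi 0, Complex.imCLM ((u ^ (a - 1) * Real.exp (-u)) •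
        Complex.exp (Real.tan θ * Complex.I * (id u : ℝ)) * Complex.exp ((-c : ℝ) * Complex.I)) := by
        refine setIntegral_congr_fun measurableSet_Ioi fun u _ => ?_
        simp only [id, Complex.imCLM_apply, Complex.real_smul]
        rw [show (Real.tan θ * Complex.I * u : ℂ) = ((u * Real.tan θ : ℝ) : ℂ) * Complex.I by
          push_cast; ring, mul_assoc (Complex.ofReal _), e1, e2, ← sub_eq_add_neg]
    _ = _ := by
        rw [h', show ((Real.cos θ ^ a : ℝ) * Complex.exp ((a * θ : ℝ) * Complex.I) *
          Real.Gamma a * Complex.exp ((-c : ℝ) * Complex.I) : ℂ) =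
          ((Real.Gamma a * Real.cos θ ^ a : ℝ) : ℂ) * (Complex.exp ((a * θ : ℝ) * Complex.I) *
            Complex.exp ((-c : ℝ) * Complex.I)) by push_cast; ring, e1, e2, ← sub_eq_add_neg]

/-- A Gamma-type measure on `(0, ∞)` with an oscillating perturbation of size `ε`. -/
def oscillatingGammaWeight (b θ ε : ℝ) : Measure ℝ :=
  (volume.restrict (Ioi 0)).withDensity fun u => ENNReal.ofReal
    (u ^ (b - 1) * Real.exp (-u) * (1 + ε * Real.sin (u * Real.tan θ - b * θ)))

instance (b θ ε : ℝ) : SFinite (oscillatingGammaWeight b θ ε) := by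
  unfold oscillatingGammaWeight; infer_instance

lemma lintegral_oscillatingGammaWeight {b θ ε p : ℝ} (hb : 0 < b) (h1 : -(Real.pi / 2) < θ)
    (h2 : θ < Real.pi / 2) (hε0 : 0 ≤ ε) (hε1 : ε ≤ 1) (hp : 0 ≤ p) :
    ∫⁻ u, ENNReal.ofReal (Real.exp (p * Real.log u)) ∂(oscillatingGammaWeight b θ ε) =
      ENNReal.ofReal (Real.Gamma (p + b) *
        (1 + ε * (Real.cos θ ^ (p + b) * Real.sin (p * θ)))) := by
  have hpb : 0 < p + b := by positivity
  have hnn (u : ℝ) : 0 ≤ 1 + ε * Real.sin (u * Real.tan θ - b * θ) := by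
    nlinarith [Real.neg_one_le_sin (u * Real.tan θ - b * θ)]
  have i1 : IntegrableOn (fun u : ℝ => u ^ (p + b - 1) * Real.exp (-u)) (Ioi 0) := by
    simpa using integrableOn_rpow_mul_exp_neg_mul hpb one_pos
  have i2 := integrable_gammaWeight_of_bounded hpb
    (f := fun u => Real.sin (u * Real.tan θ - b * θ)) (by fun_prop)
    (fun u => Real.abs_sin_le_one _)
  have v1 : ∫ u in Ioi 0, u ^ (p + b - 1) * Real.exp (-u) = Real.Gamma (p + b) := by
    simpa using Real.integral_rpow_mul_exp_neg_mul_Ioi hpb one_pos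
  have v2 := integral_rpow_mul_exp_neg_mul_sin (c := b * θ) hpb h1 h2
  have v : ∫ u in Ioi 0, (u ^ (p + b - 1) * Real.exp (-u) +
      ε * (u ^ (p + b - 1) * Real.exp (-u) * Real.sin (u * Real.tan θ - b * θ))) =
      Real.Gamma (p + b) * (1 + ε * (Real.cos θ ^ (p + b) * Real.sin (p * θ))) := by
    rw [integral_add i1 (i2.const_mul ε), integral_const_mul, v1, v2,
      show (p + b) * θ - b * θ = p * θ by ring]
    ring
  have i3 : IntegrableOn (fun u : ℝ => u ^ (p + b - 1) * Real.exp (-u) +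
      ε * (u ^ (p + b - 1) * Real.exp (-u) * Real.sin (u * Real.tan θ - b * θ))) (Ioi 0) :=
    i1.add (i2.const_mul ε)
  unfold oscillatingGammaWeight
  rw [← v, lintegral_withDensity_eq_lintegral_mul _ (by fun_prop) (by fun_prop),
    ofReal_integral_eq_lintegral_ofReal i3]
  · refine setLIntegral_congr_fun measurableSet_Ioi fun u hu => ?_
    have hu' : 0 < u := hu
    simp only [Pi.mul_apply]
    rw [← ENNReal.ofReal_mul' (by positivity), mul_comm p, ← Real.rpow_def_of_pos hu',
      show p + b - 1 = (b - 1) + p by ring, Real.rpow_add hu']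
    congr 1
    ring
  · filter_upwards [ae_restrict_mem measurableSet_Ioi] with u hu
    have hu' : 0 < u := hu
    have := mul_nonneg (show 0 ≤ u ^ (p + b - 1) * Real.exp (-u) by positivity) (hnn u)
    simp only [Pi.zero_apply]
    linarith

/-- The multiplicative convolution of the image of `oscillatingGammaWeight` under `u ↦ u ^ t` and
the image of `ρ` under `exp`. -/
def oscillatingSolution (t b ε : ℝ) (ρ : Measure ℝ) : Measure ℝ :=
  ((oscillatingGammaWeight b (Real.pi / t) ε).prod ρ).map
    fun q => Real.exp (t * Real.log q.1 + q.2)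

lemma ae_pos_oscillatingSolution (t b ε : ℝ) (ρ : Measure ℝ) :
    ∀ᵐ x ∂(oscillatingSolution t b ε ρ), 0 < x := by
  unfold oscillatingSolution
  rw [ae_map_iff (by fun_prop) measurableSet_Ioi]
  exact ae_of_all _ fun q => Real.exp_pos _

lemma lintegral_rpow_oscillatingSolution {t b ε w : ℝ} (ρ : Measure ℝ) [SFinite ρ] (ht : 2 < t)
    (hb : 0 < b) (hε0 : 0 ≤ ε) (hε1 : ε ≤ 1) (hw : 0 ≤ w) :
    ∫⁻ x, ENNReal.ofReal (x ^ w) ∂(oscillatingSolution t b ε ρ) =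
      ENNReal.ofReal (Real.Gamma (t * w + b) *
        (1 + ε * (Real.cos (Real.pi / t) ^ (t * w + b) * Real.sin (w * Real.pi)))) *
      ∫⁻ s, ENNReal.ofReal (Real.exp (w * s)) ∂ρ := by
  have hθ : Real.pi / t < Real.pi / 2 := by
    gcongr
  have hθ0 : 0 < Real.pi / t := by positivity
  unfold oscillatingSolution
  rw [lintegral_map (by fun_prop) (by fun_prop), show w * Real.pi = t * w * (Real.pi / t) by
    field_simp, ← lintegral_oscillatingGammaWeight hb (by linarith) hθ hε0 hε1 (by positivity),
    ← lintegral_prod_mul (by fun_prop) (by fun_prop)]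
  refine lintegral_congr fun q => ?_
  rw [← ENNReal.ofReal_mul (by positivity), ← Real.exp_add, ← Real.exp_mul]
  ring_nf

lemma lintegral_pow_oscillatingSolution {t b ε : ℝ} (ρ : Measure ℝ) [SFinite ρ] (ht : 2 < t)
    (hb : 0 < b) (hε0 : 0 ≤ ε) (hε1 : ε ≤ 1) {f : ℕ → ℝ}
    (hρ : ∀ n : ℕ, ∫⁻ s, ENNReal.ofReal (Real.exp (n * s)) ∂ρ =
      ENNReal.ofReal (f n / Real.Gamma (t * n + b))) (n : ℕ) :
    ∫⁻ x, ENNReal.ofReal (x ^ n) ∂(oscillatingSolution t b ε ρ) = ENNReal.ofReal (f n) := by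
  have h := lintegral_rpow_oscillatingSolution ρ ht hb hε0 hε1 n.cast_nonneg
  have hΓ : 0 < Real.Gamma (t * n + b) := Real.Gamma_pos_of_pos (by positivity)
  simp only [Real.rpow_natCast, Real.sin_nat_mul_pi, mul_zero, add_zero, mul_one] at h
  rw [h, hρ, ← ENNReal.ofReal_mul hΓ.le]
  congr 1
  field_simp

lemma eq_oscillatingSolution_of_momentDeterminate {ν : Measure ℝ} (hν : MomentDeterminate ν)
    {t b ε : ℝ} (ρ : Measure ℝ) [SFinite ρ] (ht : 2 < t) (hb : 0 < b) (hε0 : 0 ≤ ε) (hε1 : ε ≤ 1)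
    (hM : ∀ n, 0 ≤ Mnu ν n)
    (hρ : ∀ n : ℕ, ∫⁻ s, ENNReal.ofReal (Real.exp (n * s)) ∂ρ =
      ENNReal.ofReal (Mnu ν n / Real.Gamma (t * n + b))) :
    oscillatingSolution t b ε ρ = ν := by
  have hpos := ae_pos_oscillatingSolution t b ε ρ
  have hmom := lintegral_pow_oscillatingSolution ρ ht hb hε0 hε1 hρ
  have hnn (n : ℕ) : ∀ᵐ x ∂(oscillatingSolution t b ε ρ), 0 ≤ x ^ n := by
    filter_upwards [hpos] with x hx
    positivity
  refine hν _ ?_ (fun n => ⟨by fun_prop, ?_⟩) fun n => ?_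
  · refine measure_mono_null (fun x hx => ?_) (ae_iff.1 hpos)
    exact not_lt.2 (le_of_lt hx)
  · rw [hasFiniteIntegral_iff_ofReal (hnn n), hmom]
    exact ENNReal.ofReal_lt_top
  · conv_lhs => rw [Mnu, integral_eq_lintegral_of_nonneg_ae (hnn n) (by fun_prop), hmom]
    exact ENNReal.toReal_ofReal (hM n)

theorem not_momentDeterminate_of_two_lt {t : ℝ} (ht : 2 < t) {ν : Measure ℝ}
    (hM : ∀ n : ℕ, Mnu ν n = ((n : ℝ) + 1) ^ (t * (n : ℝ))) : ¬ MomentDeterminate ν := by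
  intro hν
  have ht0 : 0 < t := by linarith
  obtain ⟨ρ, _, hρ⟩ := isExpMoment_div_Gamma ht0
  simp only [← hM] at hρ
  have hM0 (n : ℕ) : 0 ≤ Mnu ν n := by rw [hM]; positivity
  have hb : 0 < t + 1 / 2 := by positivity
  have heq : oscillatingSolution t (t + 1 / 2) 0 ρ = oscillatingSolution t (t + 1 / 2) 1 ρ :=
    (eq_oscillatingSolution_of_momentDeterminate hν ρ ht hb le_rfl zero_le_one hM0 hρ).trans
      (eq_oscillatingSolution_of_momentDeterminate hν ρ ht hb zero_le_one le_rfl hM0 hρ).symm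
  have hhalf : (0 : ℝ) ≤ 1 / 2 := by norm_num
  have hL := lintegral_rpow_oscillatingSolution ρ ht hb le_rfl zero_le_one hhalf
  rw [heq, lintegral_rpow_oscillatingSolution ρ ht hb zero_le_one le_rfl hhalf] at hL
  have hρ0 : ρ ≠ 0 := by
    rintro rfl
    have h0 := hρ 0
    have hΓ : 0 < Real.Gamma (t + 1 / 2) := Real.Gamma_pos_of_pos hb
    rw [hM, lintegral_zero_measure, eq_comm, ENNReal.ofReal_eq_zero] at h0
    simp only [Nat.cast_zero, mul_zero, zero_add, Real.rpow_zero] at h0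
    exact absurd h0 (not_le.2 (by positivity))
  have hR0 : ∫⁻ s, ENNReal.ofReal (Real.exp (1 / 2 * s)) ∂ρ ≠ 0 := by
    rw [Ne, lintegral_eq_zero_iff (by fun_prop)]
    intro h
    apply hρ0
    rw [← ae_eq_bot, ← eventually_false_iff_eq_bot]
    filter_upwards [h] with s hs
    simp only [Pi.zero_apply, ENNReal.ofReal_eq_zero] at hs
    exact absurd hs (not_le.2 (Real.exp_pos _))
  have hR1 : ∫⁻ s, ENNReal.ofReal (Real.exp (1 / 2 * s)) ∂ρ ≠ ∞ := by
    have hle : ∫⁻ s, ENNReal.ofReal (Real.exp (1 / 2 * s)) ∂ρ ≤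
        ∫⁻ s, (ENNReal.ofReal (Real.exp ((0 : ℕ) * s)) +
          ENNReal.ofReal (Real.exp ((1 : ℕ) * s))) ∂ρ := by
      refine lintegral_mono fun s => ?_
      rw [← ENNReal.ofReal_add (by positivity) (by positivity)]
      refine ENNReal.ofReal_le_ofReal ?_
      have hs : Real.exp ((1 : ℕ) * s) = Real.exp (1 / 2 * s) ^ 2 := by
        rw [← Real.exp_nat_mul]; congr 1; push_cast; ring
      rw [hs]
      simp only [Nat.cast_zero, zero_mul, Real.exp_zero]
      nlinarith [sq_nonneg (Real.exp (1 / 2 * s) - 1), Real.exp_pos (1 / 2 * s)]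
    refine ne_top_of_le_ne_top ?_ hle
    rw [lintegral_add_left (by fun_prop), hρ, hρ]
    exact ENNReal.add_ne_top.2 ⟨ENNReal.ofReal_ne_top, ENNReal.ofReal_ne_top⟩
  have hΓ : 0 < Real.Gamma (t * (1 / 2) + (t + 1 / 2)) := Real.Gamma_pos_of_pos (by positivity)
  have hθ : Real.pi / t < Real.pi / 2 := by gcongr
  have hθ0 : 0 < Real.pi / t := by positivity
  have hcos : 0 < Real.cos (Real.pi / t) ^ (t * (1 / 2) + (t + 1 / 2)) :=
    Real.rpow_pos_of_pos (Real.cos_pos_of_mem_Ioo ⟨by linarith, hθ⟩) _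
  rw [ENNReal.mul_left_inj hR0 hR1, show 1 / 2 * Real.pi = Real.pi / 2 by ring,
    Real.sin_pi_div_two, ENNReal.ofReal_eq_ofReal_iff (by positivity) (by positivity)] at hL
  nlinarith [mul_pos hΓ hcos]

/-- **Theorem 2.1(2)**: if the moments of `ν` are `(n+1)^{tn}` (i.e. `e^{tΨ(n)}` with
`Ψ(u) = u log(u+1)`), then `ν` is moment determinate if and only if `t ≤ 2`. -/
theorem logLevy_threshold
    (t : ℝ) (ht : 0 < t)
    (ν : Measure ℝ) [IsProbabilityMeasure ν] (hsupp : SupportIsIci ν)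
    (hmom : ∀ n : ℕ, Integrable (fun x => x ^ n) ν)
    (hM : ∀ n : ℕ, Mnu ν n = ((n : ℝ) + 1) ^ (t * (n : ℝ))) :
    MomentDeterminate ν ↔ t ≤ 2 := by
  refine ⟨fun h => ?_, fun h => ?_⟩
  · by_contra! h2
    exact not_momentDeterminate_of_two_lt h2 hM h
  · refine momentDeterminate_of_moments_le hsupp.1 hmom fun n => ?_
    rw [hM, ← Real.rpow_natCast]
    push_cast
    gcongr
    linarith [n.cast_nonneg (α := ℝ)]
end
end
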